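/- Let d ∈ ℕ, 0 < θ ≤ ∞ and r > (1 − 1/θ)_+, and let 2 ≤ q < ∞ (or q = ∞ if d = 1). Then σ_m(S^r_θ A)_{L_q} ≍ m^{−(r + 1/θ − 1/2)} · (log* m)^{(d−1)r}. -/

import Mathlib

open MeasureTheory Real ENNReal

noncomputable section

namespace Paper

/-- The fundamental domain `[0,1)^d` of the `d`-dimensional torus `𝕋^d`. -/
def cube (d : ℕ) : Set (Fin d → ℝ) := Set.univ.pi fun _ => Set.Ico (0:ℝ) 1

/-- The trigonometric character `x ↦ e^{2π i k·x}`. -/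
def expk (d : ℕ) (k : Fin d → ℤ) (x : Fin d → ℝ) : ℂ :=
  Complex.exp (((2 * Real.pi * ∑ i, (k i : ℝ) * x i : ℝ) : ℂ) * Complex.I)

/-- Fourier coefficient `f̂(k) = ∫_{[0,1)^d} f(x) e^{-2π i k·x} dx`. -/
def fCoeff (d : ℕ) (f : (Fin d → ℝ) → ℂ) (k : Fin d → ℤ) : ℂ :=
  ∫ x in cube d, f x * expk d (-k) x

/-- The `L_q` (quasi-)norm on the torus, `q ∈ (0,∞]`, valued in `ℝ≥0∞`
(for `q = ∞` this is the essential supremum). -/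
def LqNorm (d : ℕ) (q : ℝ≥0∞) (f : (Fin d → ℝ) → ℂ) : ℝ≥0∞ :=
  eLpNorm f q (volume.restrict (cube d))

/-- The weight `∏_{i=1}^d (1+|k_i|)`. -/
def wt (d : ℕ) (k : Fin d → ℤ) : ℝ := ∏ i, (1 + |(k i : ℝ)|)

/-- The weighted Wiener (quasi-)norm `‖f‖_{S^r_θ A}`
(with the sup modification for `θ = ∞`); `A_θ` corresponds to `r = 0`,
the Wiener algebra `A` to `r = 0`, `θ = 1`. -/
def wienerNorm (d : ℕ) (r : ℝ) (θ : ℝ≥0∞) (f : (Fin d → ℝ) → ℂ) : ℝ≥0∞ :=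
  if θ = ∞ then ⨆ k : Fin d → ℤ, ENNReal.ofReal (wt d k ^ r) * (‖fCoeff d f k‖₊ : ℝ≥0∞)
  else (∑' k : Fin d → ℤ,
      (ENNReal.ofReal (wt d k ^ r) * (‖fCoeff d f k‖₊ : ℝ≥0∞)) ^ θ.toReal) ^ (1 / θ.toReal)

/-- Trigonometric polynomials with at most `m` terms. -/
def trigPoly (d m : ℕ) : Set ((Fin d → ℝ) → ℂ) :=
  {s | ∃ (Λ : Finset (Fin d → ℤ)) (a : (Fin d → ℤ) → ℂ),
    Λ.card ≤ m ∧ s = fun x => ∑ k ∈ Λ, a k * expk d k x}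

/-- Best `m`-term trigonometric approximation error of `f`, error measured by `X`. -/
def sigmaF (d m : ℕ) (X : ((Fin d → ℝ) → ℂ) → ℝ≥0∞) (f : (Fin d → ℝ) → ℂ) : ℝ≥0∞ :=
  ⨅ s ∈ trigPoly d m, X (f - s)

/-- The unit ball of the space (inside `L₁(𝕋^d)`) with (quasi-)norm `N`. -/
def unitBall (d : ℕ) (N : ((Fin d → ℝ) → ℂ) → ℝ≥0∞) : Set ((Fin d → ℝ) → ℂ) :=
  {f | IntegrableOn f (cube d) ∧ N f ≤ 1}

/-- Best `m`-term trigonometric width of the unit ball of `N`, error measured by `X`. -/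
def sigmaClass (d m : ℕ) (N X : ((Fin d → ℝ) → ℂ) → ℝ≥0∞) : ℝ≥0∞ :=
  ⨆ f ∈ unitBall d N, sigmaF d m X f

/-- `log*(m) = max (log₂ m) 1`. -/
def logStar (m : ℕ) : ℝ := max (Real.logb 2 m) 1

/-- Two-sided asymptotic equivalence `a_m ≍ b_m`. -/
def IsAsympEquiv (a : ℕ → ℝ≥0∞) (b : ℕ → ℝ) : Prop :=
  ∃ c C : ℝ, 0 < c ∧ 0 < C ∧ ∃ m₀ : ℕ, ∀ m : ℕ, m₀ ≤ m →
    ENNReal.ofReal (c * b m) ≤ a m ∧ a m ≤ ENNReal.ofReal (C * b m)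

/-- One-sided asymptotic bound `a_m ≲ b_m`. -/
def IsAsympLe (a : ℕ → ℝ≥0∞) (b : ℕ → ℝ) : Prop :=
  ∃ C : ℝ, 0 < C ∧ ∃ m₀ : ℕ, ∀ m : ℕ, m₀ ≤ m → a m ≤ ENNReal.ofReal (C * b m)

/-- Dyadic block `I_0 = {0}`, `I_n = {k : 2^{n-1} ≤ |k| < 2^n}` for `n ≥ 1`. -/
def blockF (n : ℕ) : Finset ℤ :=
  (Finset.Icc (-(2^n : ℤ)) (2^n)).filter fun k =>
    (n = 0 ∧ k = 0) ∨ (n ≠ 0 ∧ 2^(n-1) ≤ |k| ∧ |k| < 2^n)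

/-- The dyadic block projection `∑_{k ∈ I_j} f̂(k) e^{2π i k·x}`. -/
def blockProj (d : ℕ) (f : (Fin d → ℝ) → ℂ) (j : Fin d → ℕ) : (Fin d → ℝ) → ℂ :=
  fun x => ∑ k ∈ Fintype.piFinset (fun i => blockF (j i)), fCoeff d f k * expk d k x

/-- The mixed-smoothness Besov (quasi-)norm `‖f‖_{S^s_{p,θ}B}`
(with the sup modification for `θ = ∞`). -/
def besovNorm (d : ℕ) (s : ℝ) (p θ : ℝ≥0∞) (f : (Fin d → ℝ) → ℂ) : ℝ≥0∞ :=
  if θ = ∞ then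
    ⨆ j : Fin d → ℕ,
      ENNReal.ofReal ((2:ℝ) ^ (((∑ i, j i : ℕ) : ℝ) * s)) * LqNorm d p (blockProj d f j)
  else
    (∑' j : Fin d → ℕ,
      (ENNReal.ofReal ((2:ℝ) ^ (((∑ i, j i : ℕ) : ℝ) * s)) * LqNorm d p (blockProj d f j))
        ^ θ.toReal) ^ (1 / θ.toReal)

/-- The mixed-smoothness Sobolev norm `‖f‖_{S^s_p W}` (Littlewood–Paley form),
with `S^0_p W := L_p`. -/
def sobolevNorm (d : ℕ) (s : ℝ) (p : ℝ≥0∞) (f : (Fin d → ℝ) → ℂ) : ℝ≥0∞ :=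
  if s = 0 then LqNorm d p f
  else
    (∫⁻ x in cube d,
      ((∑' j : Fin d → ℕ,
        (ENNReal.ofReal ((2:ℝ) ^ (((∑ i, j i : ℕ) : ℝ) * s)) *
          (‖blockProj d f j x‖₊ : ℝ≥0∞)) ^ (2:ℕ)) ^ ((1:ℝ)/2)) ^ p.toReal) ^ (1 / p.toReal)

/-- Trigonometric polynomials with frequencies in `[-M,M]^d`. -/
def boxPoly (d M : ℕ) : Set ((Fin d → ℝ) → ℂ) :=
  {s | ∃ (Λ : Finset (Fin d → ℤ)) (a : (Fin d → ℤ) → ℂ),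
    (∀ k ∈ Λ, ∀ i, |k i| ≤ (M : ℤ)) ∧ s = fun x => ∑ k ∈ Λ, a k * expk d k x}

/-- Error of best approximation by trigonometric polynomials with
frequencies in `[-M,M]^d`, measured in `L_∞`. -/
def EBox (d M : ℕ) (f : (Fin d → ℝ) → ℂ) : ℝ≥0∞ :=
  ⨅ g ∈ boxPoly d M, LqNorm d ∞ (f - g)

/-- The `m`-th (non-linear) sampling width of the class of continuous functions
in the unit ball of `N`, error measured in `L_q`. -/
def samplingWidth (d m : ℕ) (N : ((Fin d → ℝ) → ℂ) → ℝ≥0∞) (q : ℝ≥0∞) : ℝ≥0∞ :=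
  ⨅ (t : Fin m → (Fin d → ℝ)) (_ : ∀ i, t i ∈ cube d)
    (R : (Fin m → ℂ) → ((Fin d → ℝ) → ℂ)),
    ⨆ f ∈ {f : (Fin d → ℝ) → ℂ | Continuous f ∧ N f ≤ 1},
      LqNorm d q (f - R fun i => f (t i))

/-! ### Characters on the cube -/

/-- Lebesgue measure on the fundamental domain. -/
abbrev cubeMeasure (d : ℕ) : Measure (Fin d → ℝ) := volume.restrict (cube d)

lemma cubeMeasure_eq_pi (d : ℕ) :
    cubeMeasure d = Measure.pi fun _ => (volume.restrict (Set.Ico (0:ℝ) 1)) := by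
  rw [cubeMeasure, cube, volume_pi, Measure.restrict_pi_pi]

instance isProbabilityMeasure_cubeMeasure (d : ℕ) : IsProbabilityMeasure (cubeMeasure d) := by
  refine ⟨?_⟩
  rw [Measure.restrict_apply_univ, cube, volume_pi_pi]
  simp

lemma continuous_expk (d : ℕ) (k : Fin d → ℤ) : Continuous (expk d k) := by
  unfold expk
  fun_prop

lemma norm_expk (d : ℕ) (k : Fin d → ℤ) (x : Fin d → ℝ) : ‖expk d k x‖ = 1 := by
  rw [expk, Complex.norm_exp_ofReal_mul_I]

lemma expk_add (d : ℕ) (k l : Fin d → ℤ) (x : Fin d → ℝ) :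
    expk d (k + l) x = expk d k x * expk d l x := by
  rw [expk, expk, expk, ← Complex.exp_add]
  congr 1
  push_cast [Pi.add_apply]
  simp only [add_mul, Finset.sum_add_distrib]
  ring

lemma conj_expk (d : ℕ) (k : Fin d → ℤ) (x : Fin d → ℝ) :
    (starRingEnd ℂ) (expk d k x) = expk d (-k) x := by
  rw [expk, expk, ← Complex.exp_conj, map_mul, Complex.conj_ofReal, Complex.conj_I]
  congr 1
  simp

lemma expk_eq_prod (d : ℕ) (k : Fin d → ℤ) (x : Fin d → ℝ) :
    expk d k x = ∏ i, Complex.exp (2 * Real.pi * Complex.I * (k i) * (x i)) := by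
  rw [expk, ← Complex.exp_sum]
  congr 1
  push_cast
  rw [Finset.mul_sum, Finset.sum_mul]
  refine Finset.sum_congr rfl fun i _ => ?_
  ring

lemma integral_exp_Ico (n : ℤ) :
    ∫ x in Set.Ico (0:ℝ) 1, Complex.exp (2 * Real.pi * Complex.I * n * x) =
      if n = 0 then 1 else 0 := by
  rw [integral_Ico_eq_integral_Ioc, ← intervalIntegral.integral_of_le zero_le_one]
  split_ifs with h
  · simp [h]
  · have hc : (2 * Real.pi * Complex.I * n : ℂ) ≠ 0 := by
      simp [Real.pi_ne_zero, h]
    rw [integral_exp_mul_complex hc]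
    have : Complex.exp (2 * Real.pi * Complex.I * n * (1:ℝ)) = 1 := by
      rw [Complex.exp_eq_one_iff]
      exact ⟨n, by push_cast; ring⟩
    rw [this]
    simp

lemma integral_expk (d : ℕ) (k : Fin d → ℤ) :
    ∫ x in cube d, expk d k x = if k = 0 then 1 else 0 := by
  change ∫ x, expk d k x ∂(cubeMeasure d) = _
  rw [cubeMeasure_eq_pi]
  simp_rw [expk_eq_prod]
  rw [integral_fintype_prod_eq_prod
    (f := fun (i : Fin d) (t : ℝ) => Complex.exp (2 * Real.pi * Complex.I * (k i) * t))]
  simp_rw [integral_exp_Ico]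
  rw [Finset.prod_ite_zero]
  simp [funext_iff]

lemma integrable_expk (d : ℕ) (k : Fin d → ℤ) : Integrable (expk d k) (cubeMeasure d) :=
  (integrable_const (1:ℝ)).mono' (continuous_expk d k).aestronglyMeasurable
    (Filter.Eventually.of_forall fun x => (norm_expk d k x).le)

lemma continuous_trigSum (d : ℕ) (Λ : Finset (Fin d → ℤ)) (a : (Fin d → ℤ) → ℂ) :
    Continuous fun x => ∑ k ∈ Λ, a k * expk d k x :=
  continuous_finsetSum _ fun k _ => continuous_const.mul (continuous_expk d k)

lemma norm_trigSum_le (d : ℕ) (Λ : Finset (Fin d → ℤ)) (a : (Fin d → ℤ) → ℂ) (x : Fin d → ℝ) :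
    ‖∑ k ∈ Λ, a k * expk d k x‖ ≤ ∑ k ∈ Λ, ‖a k‖ :=
  (norm_sum_le _ _).trans (by simp [norm_expk])

lemma memLp_trigSum (d : ℕ) (q : ℝ≥0∞) (Λ : Finset (Fin d → ℤ)) (a : (Fin d → ℤ) → ℂ) :
    MemLp (fun x => ∑ k ∈ Λ, a k * expk d k x) q (cubeMeasure d) :=
  MemLp.of_bound (continuous_trigSum d Λ a).aestronglyMeasurable (∑ k ∈ Λ, ‖a k‖)
    (Filter.Eventually.of_forall (norm_trigSum_le d Λ a))

lemma fCoeff_trigSum (d : ℕ) (Λ : Finset (Fin d → ℤ)) (a : (Fin d → ℤ) → ℂ) (k : Fin d → ℤ) :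
    fCoeff d (fun x => ∑ l ∈ Λ, a l * expk d l x) k = if k ∈ Λ then a k else 0 := by
  rw [fCoeff]
  have h : ∀ x, (∑ l ∈ Λ, a l * expk d l x) * expk d (-k) x =
      ∑ l ∈ Λ, a l * expk d (l - k) x := by
    intro x
    rw [Finset.sum_mul]
    refine Finset.sum_congr rfl fun l _ => ?_
    rw [sub_eq_add_neg, expk_add, mul_assoc]
  simp_rw [h]
  rw [integral_finsetSum _ fun l _ => (integrable_expk d _).const_mul _]
  simp_rw [integral_const_mul, integral_expk, sub_eq_zero]
  simp

/-- Parseval's identity for trigonometric polynomials. -/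
lemma integral_normSq_trigSum (d : ℕ) (Λ : Finset (Fin d → ℤ)) (a : (Fin d → ℤ) → ℂ) :
    ∫ x in cube d, ‖∑ k ∈ Λ, a k * expk d k x‖ ^ 2 = ∑ k ∈ Λ, ‖a k‖ ^ 2 := by
  have h : ∀ x, ((‖∑ k ∈ Λ, a k * expk d k x‖ ^ 2 : ℝ) : ℂ) =
      ∑ l ∈ Λ, (starRingEnd ℂ) (a l) *
        ((∑ k ∈ Λ, a k * expk d k x) * expk d (-l) x) := by
    intro x
    rw [Complex.ofReal_pow, ← Complex.mul_conj', map_sum, Finset.mul_sum]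
    refine Finset.sum_congr rfl fun l _ => ?_
    rw [map_mul, conj_expk]
    ring
  apply Complex.ofReal_injective
  rw [← integral_complex_ofReal]
  simp_rw [h]
  rw [integral_finsetSum]
  · simp_rw [integral_const_mul]
    have := fCoeff_trigSum d Λ a
    simp only [fCoeff] at this
    simp_rw [this]
    push_cast
    refine Finset.sum_congr rfl fun l hl => ?_
    rw [if_pos hl, Complex.conj_mul']
  · intro l _
    refine Integrable.const_mul ?_ _
    refine ((integrable_const (∑ k ∈ Λ, ‖a k‖)).mono'
      ((continuous_trigSum d Λ a).mul (continuous_expk d _)).aestronglyMeasurable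
      (Filter.Eventually.of_forall fun x => ?_))
    rw [norm_mul, norm_expk, mul_one]
    exact norm_trigSum_le d Λ a x

/-! ### Uniqueness of Fourier coefficients -/

/-- The quotient map from `ℝ^d` to the torus. -/
def toTorus (d : ℕ) (x : Fin d → ℝ) : UnitAddTorus (Fin d) := fun i => (x i : UnitAddCircle)

/-- The section of the quotient map with values in the fundamental domain. -/
def ofTorus (d : ℕ) (y : UnitAddTorus (Fin d)) : Fin d → ℝ :=
  fun i => (AddCircle.measurableEquivIco 1 0 (y i) : ℝ)

lemma measurable_toTorus (d : ℕ) : Measurable (toTorus d) :=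
  measurable_pi_lambda _ fun i => AddCircle.measurable_mk'.comp (measurable_pi_apply i)

lemma measurable_ofTorus (d : ℕ) : Measurable (ofTorus d) :=
  measurable_pi_lambda _ fun i => measurable_subtype_coe.comp
    ((AddCircle.measurableEquivIco 1 0).measurable.comp (measurable_pi_apply i))

lemma ofTorus_toTorus (d : ℕ) {x : Fin d → ℝ} (hx : x ∈ cube d) : ofTorus d (toTorus d x) = x := by
  funext i
  have hi : x i ∈ Set.Ico (0:ℝ) (0 + 1) := by
    rw [zero_add]
    exact hx i trivial
  exact congrArg Subtype.val (AddCircle.equivIco_coe_eq hi)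

lemma mFourier_toTorus (d : ℕ) (k : Fin d → ℤ) (x : Fin d → ℝ) :
    UnitAddTorus.mFourier k (toTorus d x) = expk d k x := by
  rw [expk_eq_prod]
  simp only [UnitAddTorus.mFourier, ContinuousMap.coe_mk, toTorus]
  refine Finset.prod_congr rfl fun i _ => ?_
  rw [fourier_coe_apply]
  simp

lemma measurableSet_cube (d : ℕ) : MeasurableSet (cube d) :=
  MeasurableSet.univ_pi fun _ => measurableSet_Ico

lemma measurePreserving_ofTorus (d : ℕ) :
    MeasurePreserving (ofTorus d) ((cubeMeasure d).map (toTorus d)) (cubeMeasure d) := by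
  refine ⟨measurable_ofTorus d, ?_⟩
  rw [Measure.map_map (measurable_ofTorus d) (measurable_toTorus d)]
  conv_rhs => rw [← Measure.map_id (μ := cubeMeasure d)]
  refine Measure.map_congr ?_
  filter_upwards [ae_restrict_mem (measurableSet_cube d)] with x hx
  exact ofTorus_toTorus d hx

/-- An integrable function on a finite measure space which is orthogonal to all continuous functions
vanishes almost everywhere. -/
lemma ae_eq_zero_of_forall_integral_continuousMap_eq_zero {X : Type*} [PseudoMetricSpace X]
    [MeasurableSpace X] [BorelSpace X] {μ : Measure X} {f : X → ℂ} (hf : Integrable f μ)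
    (h : ∀ φ : C(X, ℂ), ∫ x, φ x * f x ∂μ = 0) : f =ᵐ[μ] 0 := by
  refine ae_eq_zero_of_forall_setIntegral_isClosed_eq_zero hf fun F hF => ?_
  let φ : ℕ → C(X, ℂ) := fun n =>
    ⟨fun x => (((hF.apprSeq n x : NNReal) : ℝ) : ℂ), by fun_prop⟩
  have hlim : Filter.Tendsto (fun n => ∫ x, φ n x * f x ∂μ) Filter.atTop
      (nhds (∫ x, F.indicator f x ∂μ)) := by
    refine tendsto_integral_of_dominated_convergence (fun x => ‖f x‖) (fun n => ?_) hf.norm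
      (fun n => ?_) ?_
    · exact (φ n).continuous.aestronglyMeasurable.mul hf.1
    · refine Filter.Eventually.of_forall fun x => ?_
      rw [norm_mul]
      refine mul_le_of_le_one_left (norm_nonneg _) ?_
      have : hF.apprSeq n x ≤ 1 := HasOuterApproxClosed.apprSeq_apply_le_one hF n x
      simpa [φ] using this
    · refine Filter.Eventually.of_forall fun x => ?_
      have h1 := (tendsto_pi_nhds.1 (HasOuterApproxClosed.tendsto_apprSeq hF)) x
      have h2 : Filter.Tendsto (fun n => φ n x) Filter.atTop
          (nhds (((F.indicator (fun _ => (1:NNReal)) x : NNReal) : ℝ) : ℂ)) :=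
        (Complex.continuous_ofReal.tendsto _).comp ((NNReal.continuous_coe.tendsto _).comp h1)
      convert h2.mul_const (f x) using 2
      by_cases hx : x ∈ F <;> simp [hx]
  simp_rw [h] at hlim
  rw [← integral_indicator hF.measurableSet]
  exact (tendsto_nhds_unique hlim tendsto_const_nhds)

/-- An integrable function on the cube with vanishing Fourier coefficients is zero. -/
lemma ae_eq_zero_of_fCoeff_eq_zero (d : ℕ) {f : (Fin d → ℝ) → ℂ} (hf : IntegrableOn f (cube d))
    (h : ∀ k, fCoeff d f k = 0) : f =ᵐ[cubeMeasure d] 0 := by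
  set μ := (cubeMeasure d).map (toTorus d) with hμ
  have hmp := measurePreserving_ofTorus d
  have hF : Integrable (f ∘ ofTorus d) μ := hmp.integrable_comp_of_integrable hf
  have hfin : IsFiniteMeasure μ := Measure.isFiniteMeasure_map _ _
  have hφint : ∀ φ : C(UnitAddTorus (Fin d), ℂ),
      Integrable (fun y => φ y * (f ∘ ofTorus d) y) μ := fun φ =>
    hF.bdd_mul φ.continuous.aestronglyMeasurable
      (Filter.Eventually.of_forall fun y => φ.norm_coe_le_norm y)
  let T : C(UnitAddTorus (Fin d), ℂ) →L[ℂ] ℂ :=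
    LinearMap.mkContinuous
      { toFun := fun φ => ∫ y, φ y * (f ∘ ofTorus d) y ∂μ
        map_add' := fun φ ψ => by
          simp only [ContinuousMap.add_apply, add_mul]
          exact integral_add (hφint φ) (hφint ψ)
        map_smul' := fun c φ => by
          simp only [ContinuousMap.smul_apply, smul_eq_mul, mul_assoc, RingHom.id_apply]
          exact integral_const_mul _ _ }
      (∫ y, ‖(f ∘ ofTorus d) y‖ ∂μ) (fun φ => by
        rw [mul_comm, ← integral_const_mul]
        refine norm_integral_le_of_norm_le (hF.norm.const_mul _) ?_
        refine Filter.Eventually.of_forall fun y => ?_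
        rw [norm_mul]
        exact mul_le_mul_of_nonneg_right (φ.norm_coe_le_norm y) (norm_nonneg _))
  have hT0 : ∀ k, T (UnitAddTorus.mFourier k) = 0 := by
    intro k
    change ∫ y, UnitAddTorus.mFourier k y * (f ∘ ofTorus d) y ∂μ = 0
    rw [hμ, integral_map (measurable_toTorus d).aemeasurable (hφint _).1, ← h (-k), fCoeff]
    refine integral_congr_ae ?_
    filter_upwards [ae_restrict_mem (measurableSet_cube d)] with x hx
    rw [Function.comp_apply, ofTorus_toTorus d hx, mFourier_toTorus, neg_neg, mul_comm]
  have hTz : ∀ φ, T φ = 0 := by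
    have hle : (Submodule.span ℂ (Set.range <| UnitAddTorus.mFourier (d := Fin d))).topologicalClosure
        ≤ LinearMap.ker T.toLinearMap := by
      refine Submodule.topologicalClosure_minimal _ ?_ T.isClosed_ker
      rw [Submodule.span_le]
      rintro _ ⟨k, rfl⟩
      exact hT0 k
    rw [UnitAddTorus.span_mFourier_closure_eq_top] at hle
    exact fun φ => hle trivial
  have h0 : f ∘ ofTorus d =ᵐ[μ] 0 :=
    ae_eq_zero_of_forall_integral_continuousMap_eq_zero hF hTz
  have h1 := ae_of_ae_map (measurable_toTorus d).aemeasurable h0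
  filter_upwards [h1, ae_restrict_mem (measurableSet_cube d)] with x hx hxc
  simpa [ofTorus_toTorus d hxc] using hx

/-- A function with absolutely summable Fourier coefficients is approximated by its
partial Fourier sums in every `L_q`. -/
lemma exists_LqNorm_sub_partialSum_le (d : ℕ) (q : ℝ≥0∞) {f : (Fin d → ℝ) → ℂ}
    (hf : IntegrableOn f (cube d)) (hs : Summable fun k => ‖fCoeff d f k‖) {η : ℝ} (hη : 0 < η) :
    ∃ S₀ : Finset (Fin d → ℤ), ∀ S, S₀ ⊆ S →
      LqNorm d q (fun x => f x - ∑ k ∈ S, fCoeff d f k * expk d k x) ≤ ENNReal.ofReal η := by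
  set g : (Fin d → ℝ) → ℂ := fun x => ∑' k, fCoeff d f k * expk d k x with hg
  have hnorm : ∀ x, Summable fun k => ‖fCoeff d f k * expk d k x‖ := by
    intro x
    simpa [norm_expk] using hs
  have hgc : Continuous g := by
    refine continuous_tsum (fun k => continuous_const.mul (continuous_expk d k)) hs fun k x => ?_
    simp [norm_expk]
  have hgi : Integrable g (cubeMeasure d) := by
    refine (integrable_const (∑' k, ‖fCoeff d f k‖)).mono' hgc.aestronglyMeasurable
      (Filter.Eventually.of_forall fun x => ?_)
    refine (norm_tsum_le_tsum_norm (hnorm x)).trans (le_of_eq ?_)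
    simp [norm_expk]
  have hgk : ∀ l, fCoeff d g l = fCoeff d f l := by
    intro l
    rw [fCoeff]
    have h1 : ∀ x, g x * expk d (-l) x = ∑' k, fCoeff d f k * expk d (k - l) x := by
      intro x
      rw [hg, ← tsum_mul_right]
      refine tsum_congr fun k => ?_
      rw [sub_eq_add_neg, expk_add, mul_assoc]
    simp_rw [h1]
    rw [← integral_tsum_of_summable_integral_norm
      (fun k => (integrable_expk d (k - l)).const_mul _)]
    · simp_rw [integral_const_mul, integral_expk, sub_eq_zero]
      simp
    · simpa [norm_expk] using hs
  have hfg : f =ᵐ[cubeMeasure d] g := by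
    have hz : f - g =ᵐ[cubeMeasure d] 0 := by
      refine ae_eq_zero_of_fCoeff_eq_zero d (hf.sub hgi) fun k => ?_
      have := hgk k
      rw [fCoeff] at this ⊢
      simp only [Pi.sub_apply, sub_mul]
      rw [integral_sub, this, fCoeff, sub_self]
      · exact hf.mul_bdd (c := 1) (continuous_expk d _).aestronglyMeasurable
          (Filter.Eventually.of_forall fun x => (norm_expk d _ x).le)
      · exact hgi.mul_bdd (c := 1) (continuous_expk d _).aestronglyMeasurable
          (Filter.Eventually.of_forall fun x => (norm_expk d _ x).le)
    filter_upwards [hz] with x hx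
    exact sub_eq_zero.1 hx
  obtain ⟨S₀, hS₀⟩ := ((tendsto_order.1 (tendsto_tsum_compl_atTop_zero
    fun k => ‖fCoeff d f k‖)).2 η hη).exists_forall_of_atTop
  refine ⟨S₀, fun S hS => ?_⟩
  have hb : ∀ᵐ x ∂(cubeMeasure d), ‖f x - ∑ k ∈ S, fCoeff d f k * expk d k x‖ ≤ η := by
    filter_upwards [hfg] with x hx
    have hsum := (hnorm x).of_norm
    rw [hx, show g x = ∑' k, fCoeff d f k * expk d k x from rfl,
      ← hsum.sum_add_tsum_compl (s := S), add_sub_cancel_left]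
    refine (norm_tsum_le_tsum_norm ((hnorm x).subtype _)).trans ?_
    refine le_trans (le_of_eq ?_) (hS₀ S hS).le
    simp only [norm_mul, norm_expk, mul_one]
    rfl
  refine (eLpNorm_le_of_ae_bound hb).trans ?_
  simp

/-! ### Sparse approximation by repeated halving -/

section Halving

variable {ι : Type*} [DecidableEq ι]

/-- The vector supported on `S` with value `1` on `T` and `-1` off `T`. -/
def signVec (S T : Finset ι) (k : ι) : ℂ := if k ∈ S then (if k ∈ T then 1 else -1) else 0

/-- Every subset of `B` has a signing with discrepancy at most `A * #S ^ α`. -/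
def HasSigning (p : Seminorm ℂ (ι → ℂ)) (B : Finset ι) (A α : ℝ) : Prop :=
  ∀ S ⊆ B, ∃ T ⊆ S, p (signVec S T) ≤ A * (S.card : ℝ) ^ α

variable {p : Seminorm ℂ (ι → ℂ)} {B : Finset ι} {A α : ℝ}

lemma HasSigning.exists_minority (h : HasSigning p B A α) {S : Finset ι} (hS : S ⊆ B) :
    ∃ T ⊆ S, 2 * T.card ≤ S.card ∧ p (signVec S T) ≤ A * (S.card : ℝ) ^ α := by
  obtain ⟨T, hT, hp⟩ := h S hS
  by_cases hc : 2 * T.card ≤ S.card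
  · exact ⟨T, hT, hc, hp⟩
  · refine ⟨S \ T, Finset.sdiff_subset, ?_, ?_⟩
    · have := Finset.card_sdiff_add_card_eq_card hT
      omega
    · have : signVec S (S \ T) = -signVec S T := by
        funext k
        by_cases h1 : k ∈ S <;> by_cases h2 : k ∈ T <;> simp [signVec, h1, h2]
      rwa [this, map_neg_eq_map]

lemma HasSigning.halve (h : HasSigning p B A α) (hA : 0 ≤ A) (hα : 0 ≤ α) {n : ℕ} {a : ι → ℕ}
    (ha : ∀ k ∉ B, a k = 0) (hn : ∑ k ∈ B, a k ≤ 2 * n) :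
    ∃ a' : ι → ℕ, (∀ k ∉ B, a' k = 0) ∧ ∑ k ∈ B, a' k ≤ n ∧
      p (fun k => (a k : ℂ) - 2 * (a' k : ℂ)) ≤ A * (2 * n : ℝ) ^ α := by
  set S := B.filter fun k => a k % 2 = 1 with hS
  have hSB : S ⊆ B := Finset.filter_subset _ _
  obtain ⟨T, hTS, hTc, hTp⟩ := h.exists_minority hSB
  have hSsum : ∑ k ∈ B, a k % 2 = S.card := by
    rw [hS, Finset.card_filter]
    refine Finset.sum_congr rfl fun k _ => ?_
    split_ifs <;> omega
  have hsplit : ∑ k ∈ B, a k = 2 * ∑ k ∈ B, a k / 2 + S.card := by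
    rw [← hSsum, Finset.mul_sum, ← Finset.sum_add_distrib]
    refine Finset.sum_congr rfl fun k _ => ?_
    omega
  have hTsum : ∑ k ∈ B, (if k ∈ T then 1 else 0) = T.card := by
    rw [← Finset.sum_filter, Finset.sum_const, smul_eq_mul, mul_one,
      Finset.filter_mem_eq_inter, Finset.inter_eq_right.2 (hTS.trans hSB)]
  refine ⟨fun k => a k / 2 + if k ∈ T then 1 else 0, fun k hk => ?_, ?_, ?_⟩
  · have : k ∉ T := fun hkT => hk (hSB (hTS hkT))
    simp [this, ha k hk]
  · rw [Finset.sum_add_distrib, hTsum]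
    omega
  · have hv : (fun k => (a k : ℂ) - 2 * ((a k / 2 + if k ∈ T then 1 else 0 : ℕ) : ℂ)) =
        -signVec S T := by
      funext k
      have hk2 : (a k : ℂ) = 2 * ((a k / 2 : ℕ) : ℂ) + ((a k % 2 : ℕ) : ℂ) := by
        exact_mod_cast (Nat.div_add_mod (a k) 2).symm
      have hz : k ∉ S → a k % 2 = 0 := by
        intro hkS
        by_cases hkB : k ∈ B
        · have : ¬ a k % 2 = 1 := fun h1 => hkS (Finset.mem_filter.2 ⟨hkB, h1⟩)
          omega
        · simp [ha k hkB]
      rw [hk2]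
      by_cases hkS : k ∈ S
      · have h1 : a k % 2 = 1 := (Finset.mem_filter.1 hkS).2
        by_cases hkT : k ∈ T <;> simp [signVec, hkS, hkT, h1]
        ring
      · have hkT : k ∉ T := fun hh => hkS (hTS hh)
        simp [signVec, hkS, hkT, hz hkS]
    rw [hv, map_neg_eq_map]
    refine hTp.trans ?_
    gcongr
    have : S.card ≤ 2 * n := by omega
    exact_mod_cast this

lemma two_rpow_le (hα : α ≤ 1 / 2) : (2:ℝ) ^ α ≤ 3 / 2 := by
  refine (Real.rpow_le_rpow_of_exponent_le one_le_two hα).trans ?_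
  rw [← Real.sqrt_eq_rpow, Real.sqrt_le_left (by norm_num)]
  norm_num

lemma HasSigning.halve_iterate (h : HasSigning p B A α) (hA : 0 ≤ A) (hα : 0 ≤ α)
    (hα' : α ≤ 1 / 2) (n s : ℕ) {a : ι → ℕ}
    (ha : ∀ k ∉ B, a k = 0) (hn : ∑ k ∈ B, a k ≤ 2 ^ s * n) :
    ∃ a' : ι → ℕ, (∀ k ∉ B, a' k = 0) ∧ ∑ k ∈ B, a' k ≤ n ∧
      p (fun k => (a k : ℂ) - 2 ^ s * (a' k : ℂ)) ≤
        2 ^ s * (3 * (1 - (3 / 4) ^ s) * A * (n : ℝ) ^ α) := by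
  induction s generalizing a with
  | zero =>
    refine ⟨a, ha, by simpa using hn, ?_⟩
    have : (fun k => (a k : ℂ) - 2 ^ 0 * (a k : ℂ)) = 0 := by
      funext k
      simp
    rw [this]
    simp
  | succ s ih =>
    obtain ⟨a₁, h1, h2, h3⟩ := h.halve hA hα (n := 2 ^ s * n) ha (by rw [pow_succ] at hn; linarith)
    obtain ⟨a₂, g1, g2, g3⟩ := ih h1 h2
    refine ⟨a₂, g1, g2, ?_⟩
    have hsplit : (fun k => (a k : ℂ) - 2 ^ (s + 1) * (a₂ k : ℂ)) =
        (fun k => (a k : ℂ) - 2 * (a₁ k : ℂ)) +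
          (2 : ℂ) • (fun k => (a₁ k : ℂ) - 2 ^ s * (a₂ k : ℂ)) := by
      funext k
      simp only [Pi.add_apply, Pi.smul_apply, smul_eq_mul]
      ring
    have hpow : (2 * ((2 ^ s * n : ℕ) : ℝ)) ^ α ≤ 2 ^ (s + 1) * (3 / 4) ^ (s + 1) * (n : ℝ) ^ α := by
      have e1 : (2 * ((2 ^ s * n : ℕ) : ℝ)) = (2:ℝ) ^ (s + 1) * n := by
        push_cast
        ring
      rw [e1, Real.mul_rpow (by positivity) (by positivity)]
      gcongr
      rw [← mul_pow, ← Real.rpow_natCast, ← Real.rpow_natCast, ← Real.rpow_mul zero_le_two,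
        mul_comm, Real.rpow_mul zero_le_two]
      refine Real.rpow_le_rpow (by positivity) ((two_rpow_le hα').trans (by norm_num))
        (by positivity)
    rw [hsplit]
    refine (map_add_le_add p _ _).trans ?_
    rw [map_smul_eq_mul, Complex.norm_ofNat]
    have e3 := mul_le_mul_of_nonneg_left hpow hA
    calc _ ≤ A * (2 ^ (s + 1) * (3 / 4) ^ (s + 1) * (n : ℝ) ^ α) +
          2 * (2 ^ s * (3 * (1 - (3 / 4) ^ s) * A * (n : ℝ) ^ α)) := by
          gcongr
          exact h3.trans e3
      _ = _ := by ring

lemma HasSigning.exists_sparse_nonneg (h : HasSigning p B A α)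
    (hp : ∀ c : ι → ℂ, (∀ k ∉ B, c k = 0) → p c ≤ ∑ k ∈ B, ‖c k‖) (hA : 1 ≤ A) (hα : 0 ≤ α)
    (hα' : α ≤ 1 / 2) {m : ℕ} (hm : 1 ≤ m) {w : ι → ℝ} (hw0 : ∀ k, 0 ≤ w k)
    (hwB : ∀ k ∉ B, w k = 0) (hw1 : ∑ k ∈ B, w k ≤ 1) :
    ∃ b : ι → ℂ, ∃ Λ ⊆ B, Λ.card ≤ m ∧ (∀ k ∉ Λ, b k = 0) ∧
      p (fun k => (w k : ℂ) - b k) ≤ 4 * A * (m : ℝ) ^ (α - 1) := by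
  have hm0 : (0:ℝ) < m := by exact_mod_cast hm
  have hA0 : 0 ≤ A := zero_le_one.trans hA
  obtain ⟨s, hs⟩ := pow_unbounded_of_one_lt (B.card : ℝ) one_lt_two
  set a : ι → ℕ := fun k => ⌊(2:ℝ) ^ s * m * w k⌋₊ with ha
  have haB : ∀ k ∉ B, a k = 0 := fun k hk => by simp [ha, hwB k hk]
  have hale : ∀ k, (a k : ℝ) ≤ 2 ^ s * m * w k := fun k =>
    Nat.floor_le (mul_nonneg (by positivity) (hw0 k))
  have halt : ∀ k, 2 ^ s * m * w k < a k + 1 := fun k => Nat.lt_floor_add_one _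
  have hasum : ∑ k ∈ B, a k ≤ 2 ^ s * m := by
    have : ((∑ k ∈ B, a k : ℕ) : ℝ) ≤ 2 ^ s * m := by
      push_cast
      calc ∑ k ∈ B, (a k : ℝ) ≤ ∑ k ∈ B, 2 ^ s * m * w k := Finset.sum_le_sum fun k _ => hale k
        _ = 2 ^ s * m * ∑ k ∈ B, w k := by rw [Finset.mul_sum]
        _ ≤ 2 ^ s * m * 1 := by gcongr
        _ = _ := mul_one _
    exact_mod_cast this
  obtain ⟨a', h1, h2, h3⟩ := h.halve_iterate hA0 hα hα' m s haB hasum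
  refine ⟨fun k => (a' k : ℂ) / m, B.filter fun k => a' k ≠ 0, Finset.filter_subset _ _, ?_, ?_, ?_⟩
  · refine le_trans ?_ h2
    rw [Finset.card_eq_sum_ones, Finset.sum_filter]
    refine Finset.sum_le_sum fun k _ => ?_
    split_ifs <;> omega
  · intro k hk
    have : a' k = 0 := by
      by_contra hne
      by_cases hkB : k ∈ B
      · exact hk (Finset.mem_filter.2 ⟨hkB, hne⟩)
      · exact hne (h1 k hkB)
    simp [this]
  · have hsplit : (fun k => (w k : ℂ) - (a' k : ℂ) / m) =
        (((2:ℝ) ^ s * m)⁻¹ : ℂ) • ((fun k => (2:ℂ) ^ s * m * w k - (a k : ℂ)) +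
          fun k => (a k : ℂ) - 2 ^ s * (a' k : ℂ)) := by
      funext k
      simp only [Pi.add_apply, Pi.smul_apply, smul_eq_mul]
      have : (m : ℂ) ≠ 0 := by exact_mod_cast hm0.ne'
      push_cast
      field_simp
      ring
    have hr1 : p (fun k => (2:ℂ) ^ s * m * w k - (a k : ℂ)) ≤ 2 ^ s := by
      refine (hp _ fun k hk => by simp [hwB k hk, haB k hk]).trans ?_
      refine le_trans ?_ hs.le
      rw [Finset.card_eq_sum_ones, Nat.cast_sum]
      refine Finset.sum_le_sum fun k _ => ?_
      have : (2:ℂ) ^ s * m * w k - (a k : ℂ) = ((2 ^ s * m * w k - a k : ℝ) : ℂ) := by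
        push_cast
        ring
      rw [this, Complex.norm_real, Real.norm_eq_abs, abs_le]
      have := hale k
      have := halt k
      constructor <;> push_cast <;> linarith
    have hone : 1 ≤ A * (m : ℝ) ^ α :=
      one_le_mul_of_one_le_of_one_le hA (Real.one_le_rpow (by exact_mod_cast hm) hα)
    have hr2 : 2 ^ s * (3 * (1 - (3 / 4) ^ s) * A * (m : ℝ) ^ α) ≤ 2 ^ s * (3 * (A * (m : ℝ) ^ α)) := by
      have : (0:ℝ) ≤ (3 / 4) ^ s := by positivity
      have : (3 * (1 - (3 / 4) ^ s) * A * (m : ℝ) ^ α) ≤ 3 * (A * (m : ℝ) ^ α) := by nlinarith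
      gcongr
    rw [hsplit, map_smul_eq_mul]
    have hn : ‖(((2:ℝ) ^ s * m)⁻¹ : ℂ)‖ = (2 ^ s * (m:ℝ))⁻¹ := by simp
    rw [hn, Real.rpow_sub_one hm0.ne']
    calc _ ≤ (2 ^ s * (m:ℝ))⁻¹ * (2 ^ s * (A * (m : ℝ) ^ α) + 2 ^ s * (3 * (A * (m : ℝ) ^ α))) := by
          gcongr
          refine (map_add_le_add p _ _).trans (add_le_add (hr1.trans ?_) (h3.trans hr2))
          exact le_mul_of_one_le_right (by positivity) hone
      _ = _ := by field_simp; ring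

/-- Maurey-type sparse approximation of vectors with small `ℓ₁` norm. -/
lemma HasSigning.exists_sparse (h : HasSigning p B A α)
    (hp : ∀ c : ι → ℂ, (∀ k ∉ B, c k = 0) → p c ≤ ∑ k ∈ B, ‖c k‖) (hA : 1 ≤ A) (hα : 0 ≤ α)
    (hα' : α ≤ 1 / 2) {t : ℝ} (ht : 0 < t) {c : ι → ℂ} (hc : ∀ k ∉ B, c k = 0) :
    ∃ b : ι → ℂ, ∃ Λ ⊆ B, (Λ.card : ℝ) ≤ t ∧ (∀ k ∉ Λ, b k = 0) ∧
      p (c - b) ≤ 128 * A * t ^ (α - 1) * ∑ k ∈ B, ‖c k‖ := by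
  set L := ∑ k ∈ B, ‖c k‖ with hL
  have hL0 : 0 ≤ L := Finset.sum_nonneg fun k _ => norm_nonneg _
  by_cases htl : t < 4
  · refine ⟨0, ∅, by simp, by simpa using ht.le, by simp, ?_⟩
    rw [sub_zero]
    refine (hp c hc).trans (le_mul_of_one_le_left hL0 ?_)
    have h1 : 1 ≤ (t / 4) ^ (α - 1) :=
      Real.one_le_rpow_of_pos_of_le_one_of_nonpos (by positivity) (by linarith) (by linarith)
    rw [Real.div_rpow ht.le (by norm_num)] at h1
    have h2 : (1:ℝ) / 4 ≤ 4 ^ (α - 1) := by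
      rw [show (1:ℝ) / 4 = 4 ^ (-1 : ℝ) by norm_num [Real.rpow_neg_one]]
      exact Real.rpow_le_rpow_of_exponent_le (by norm_num) (by linarith)
    rw [le_div_iff₀ (by positivity), one_mul] at h1
    nlinarith
  rcases hL0.eq_or_lt with hz | hLpos
  · refine ⟨0, ∅, by simp, by simpa using ht.le, by simp, ?_⟩
    rw [sub_zero, ← hz, mul_zero]
    exact (hp c hc).trans (by rw [← hL, ← hz])
  push Not at htl
  set m := ⌊t / 4⌋₊ with hm
  have hm1 : 1 ≤ m := Nat.le_floor (by push_cast; linarith)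
  have hmt : (m : ℝ) ≤ t / 4 := Nat.floor_le (by positivity)
  have hmt' : t / 8 ≤ m := by
    have h1 : t / 4 < m + 1 := Nat.lt_floor_add_one _
    have h2 : (1:ℝ) ≤ m := by exact_mod_cast hm1
    linarith
  have key : ∀ g : ι → ℝ, (∀ k, |g k| ≤ ‖c k‖) → ∃ b : ι → ℂ, ∃ Λ ⊆ B, Λ.card ≤ m ∧
      (∀ k ∉ Λ, b k = 0) ∧
      p (fun k => ((max (g k) 0 / L : ℝ) : ℂ) - b k) ≤ 4 * A * (m : ℝ) ^ (α - 1) := by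
    intro g hg
    refine h.exists_sparse_nonneg hp hA hα hα' hm1 (w := fun k => max (g k) 0 / L)
      (fun k => by positivity) (fun k hk => ?_) ?_
    · have := hg k
      rw [hc k hk, norm_zero] at this
      have : g k = 0 := abs_nonpos_iff.1 this
      simp [this]
    · rw [← Finset.sum_div, div_le_one hLpos]
      exact Finset.sum_le_sum fun k _ =>
        max_le ((le_abs_self _).trans (hg k)) (norm_nonneg _)
  obtain ⟨b1, Λ1, s1, c1, z1, p1⟩ := key (fun k => (c k).re) fun k => Complex.abs_re_le_norm _
  obtain ⟨b2, Λ2, s2, c2, z2, p2⟩ := key (fun k => -(c k).re) fun k => by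
    rw [abs_neg]
    exact Complex.abs_re_le_norm _
  obtain ⟨b3, Λ3, s3, c3, z3, p3⟩ := key (fun k => (c k).im) fun k => Complex.abs_im_le_norm _
  obtain ⟨b4, Λ4, s4, c4, z4, p4⟩ := key (fun k => -(c k).im) fun k => by
    rw [abs_neg]
    exact Complex.abs_im_le_norm _
  refine ⟨fun k => L * (b1 k - b2 k + Complex.I * (b3 k - b4 k)), Λ1 ∪ Λ2 ∪ (Λ3 ∪ Λ4),
    Finset.union_subset (Finset.union_subset s1 s2) (Finset.union_subset s3 s4), ?_, ?_, ?_⟩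
  · have : (Λ1 ∪ Λ2 ∪ (Λ3 ∪ Λ4)).card ≤ 4 * m := by
      have := Finset.card_union_le (Λ1 ∪ Λ2) (Λ3 ∪ Λ4)
      have := Finset.card_union_le Λ1 Λ2
      have := Finset.card_union_le Λ3 Λ4
      omega
    have : ((Λ1 ∪ Λ2 ∪ (Λ3 ∪ Λ4)).card : ℝ) ≤ 4 * m := by exact_mod_cast this
    linarith
  · intro k hk
    simp only [Finset.mem_union, not_or] at hk
    simp [z1 k hk.1.1, z2 k hk.1.2, z3 k hk.2.1, z4 k hk.2.2]
  · set f1 : ι → ℂ := fun k => ((max ((c k).re) 0 / L : ℝ) : ℂ) - b1 k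
    set f2 : ι → ℂ := fun k => ((max (-(c k).re) 0 / L : ℝ) : ℂ) - b2 k
    set f3 : ι → ℂ := fun k => ((max ((c k).im) 0 / L : ℝ) : ℂ) - b3 k
    set f4 : ι → ℂ := fun k => ((max (-(c k).im) 0 / L : ℝ) : ℂ) - b4 k
    have hsplit : (c - fun k => L * (b1 k - b2 k + Complex.I * (b3 k - b4 k))) =
        (L : ℂ) • ((f1 - f2) + Complex.I • (f3 - f4)) := by
      funext k
      have hLC : (L : ℂ) ≠ 0 := by exact_mod_cast hLpos.ne'
      have e1 : (c k).re = max ((c k).re) 0 - max (-(c k).re) 0 := by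
        rcases le_total 0 (c k).re with h0 | h0
        · rw [max_eq_left h0, max_eq_right (by linarith)]; ring
        · rw [max_eq_right h0, max_eq_left (by linarith)]; ring
      have e2 : (c k).im = max ((c k).im) 0 - max (-(c k).im) 0 := by
        rcases le_total 0 (c k).im with h0 | h0
        · rw [max_eq_left h0, max_eq_right (by linarith)]; ring
        · rw [max_eq_right h0, max_eq_left (by linarith)]; ring
      have e3 : c k = ((max ((c k).re) 0 - max (-(c k).re) 0 : ℝ) : ℂ) +
          ((max ((c k).im) 0 - max (-(c k).im) 0 : ℝ) : ℂ) * Complex.I := by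
        rw [← e1, ← e2, Complex.re_add_im]
      simp only [Pi.sub_apply, Pi.add_apply, Pi.smul_apply, smul_eq_mul, f1, f2, f3, f4]
      nth_rw 1 [e3]
      push_cast
      field_simp
      ring
    rw [hsplit, map_smul_eq_mul, Complex.norm_real, Real.norm_of_nonneg hL0]
    have hsum : p ((f1 - f2) + Complex.I • (f3 - f4)) ≤ 4 * (4 * A * (m : ℝ) ^ (α - 1)) := by
      have q1 := map_add_le_add p (f1 - f2) (Complex.I • (f3 - f4))
      rw [map_smul_eq_mul, Complex.norm_I, one_mul] at q1
      have q2 := map_sub_le_add p f1 f2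
      have q3 := map_sub_le_add p f3 f4
      linarith
    have hmpow : (m : ℝ) ^ (α - 1) ≤ 8 * t ^ (α - 1) := by
      have r1 : (m : ℝ) ^ (α - 1) ≤ (t / 8) ^ (α - 1) :=
        Real.rpow_le_rpow_of_nonpos (by positivity) hmt' (by linarith)
      rw [Real.div_rpow ht.le (by norm_num)] at r1
      have r2 : (1:ℝ) / 8 ≤ 8 ^ (α - 1) := by
        rw [show (1:ℝ) / 8 = 8 ^ (-1 : ℝ) by norm_num [Real.rpow_neg_one]]
        exact Real.rpow_le_rpow_of_exponent_le (by norm_num) (by linarith)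
      refine r1.trans ?_
      rw [div_le_iff₀ (by positivity)]
      have : 0 < t ^ (α - 1) := by positivity
      nlinarith
    calc L * p ((f1 - f2) + Complex.I • (f3 - f4)) ≤ L * (4 * (4 * A * (8 * t ^ (α - 1)))) := by
          gcongr
          refine hsum.trans ?_
          gcongr
      _ = _ := by ring

end Halving

/-! ### Moments of Rademacher sums -/

section Rademacher

variable {ι : Type*} [DecidableEq ι]

/-- The signed sum of `a` over `S`, with sign `+` on `T` and `-` off `T`. -/
def signSum (S T : Finset ι) (a : ι → ℝ) : ℝ := ∑ k ∈ S, (if k ∈ T then 1 else -1) * a k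

lemma sum_exp_signSum_le (S : Finset ι) (a : ι → ℝ) :
    ∑ T ∈ S.powerset, Real.exp (signSum S T a) ≤
      2 ^ S.card * Real.exp ((∑ k ∈ S, a k ^ 2) / 2) := by
  have h1 : ∀ T ∈ S.powerset, Real.exp (signSum S T a) =
      (∏ k ∈ T, Real.exp (a k)) * ∏ k ∈ S \ T, Real.exp (-a k) := by
    intro T hT
    rw [Finset.mem_powerset] at hT
    rw [← Real.exp_sum, ← Real.exp_sum, ← Real.exp_add, signSum, ← Finset.sum_sdiff hT, add_comm]
    congr 2
    · exact Finset.sum_congr rfl fun k hk => by rw [if_pos hk, one_mul]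
    · exact Finset.sum_congr rfl fun k hk => by
        rw [if_neg (Finset.mem_sdiff.1 hk).2, neg_one_mul]
  rw [Finset.sum_congr rfl h1, ← Finset.prod_add, Finset.sum_div, Real.exp_sum,
    ← Finset.prod_const, ← Finset.prod_mul_distrib]
  refine Finset.prod_le_prod (fun k _ => by positivity) fun k _ => ?_
  have := Real.cosh_le_exp_half_sq (a k)
  rw [Real.cosh_eq] at this
  linarith

lemma pow_two_mul_le_cosh (p : ℕ) (y : ℝ) : y ^ (2 * p) ≤ (2 * p).factorial * Real.cosh y := by
  have h := le_hasSum (Real.hasSum_cosh y) p fun n _ => by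
    rw [pow_mul]
    positivity
  rwa [div_le_iff₀ (by positivity), mul_comm (Real.cosh y)] at h

lemma sum_signSum_pow_le (S : Finset ι) {a : ι → ℝ} (ha : ∀ k, |a k| ≤ 1) (p : ℕ) :
    ∑ T ∈ S.powerset, signSum S T a ^ (2 * p) ≤
      2 ^ S.card * (2 * (2 * p).factorial * (S.card : ℝ) ^ p) := by
  rcases S.eq_empty_or_nonempty with rfl | hS
  · rcases p.eq_zero_or_pos with rfl | hp
    · simp
    · simp [signSum, hp.ne']
  have hn : (0:ℝ) < S.card := by exact_mod_cast hS.card_pos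
  set s := Real.sqrt S.card with hs
  have hs0 : 0 < s := Real.sqrt_pos.2 hn
  have hs2 : s ^ 2 = S.card := Real.sq_sqrt hn.le
  have hexp : ∀ b : ι → ℝ, (∀ k, |b k| ≤ 1) →
      ∑ T ∈ S.powerset, Real.exp (signSum S T b / s) ≤ 2 ^ S.card * 2 := by
    intro b hb
    have h1 : ∀ T, signSum S T b / s = signSum S T (fun k => b k / s) := by
      intro T
      rw [signSum, signSum, Finset.sum_div]
      exact Finset.sum_congr rfl fun k _ => by ring
    simp_rw [h1]
    refine (sum_exp_signSum_le S _).trans ?_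
    gcongr
    have h2 : ∑ k ∈ S, (b k / s) ^ 2 ≤ 1 := by
      simp_rw [div_pow, hs2]
      rw [← Finset.sum_div, div_le_one hn, Finset.card_eq_sum_ones, Nat.cast_sum]
      refine Finset.sum_le_sum fun k _ => ?_
      simpa using hb k
    calc Real.exp ((∑ k ∈ S, (b k / s) ^ 2) / 2) ≤ Real.exp (1 / 2) := by gcongr
      _ ≤ 2 := by
        have h3 := Real.exp_one_lt_d9
        have h4 : Real.exp (1 / 2) * Real.exp (1 / 2) = Real.exp 1 := by
          rw [← Real.exp_add]
          norm_num
        nlinarith [Real.exp_pos (1 / 2)]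
  have hcosh : ∑ T ∈ S.powerset, Real.cosh (signSum S T a / s) ≤ 2 ^ S.card * 2 := by
    have e1 := hexp a ha
    have e2 := hexp (fun k => -a k) (fun k => by simpa using ha k)
    have e3 : ∀ T, signSum S T (fun k => -a k) / s = -(signSum S T a / s) := by
      intro T
      simp [signSum, neg_div]
    simp_rw [e3] at e2
    simp_rw [Real.cosh_eq]
    rw [← Finset.sum_div, Finset.sum_add_distrib]
    linarith
  calc ∑ T ∈ S.powerset, signSum S T a ^ (2 * p)
      ≤ ∑ T ∈ S.powerset, s ^ (2 * p) * ((2 * p).factorial * Real.cosh (signSum S T a / s)) := by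
        refine Finset.sum_le_sum fun T _ => ?_
        have := pow_two_mul_le_cosh p (signSum S T a / s)
        rwa [div_pow, div_le_iff₀ (by positivity), mul_comm _ (s ^ (2 * p))] at this
    _ = s ^ (2 * p) * (2 * p).factorial * ∑ T ∈ S.powerset, Real.cosh (signSum S T a / s) := by
        rw [Finset.mul_sum]
        exact Finset.sum_congr rfl fun T _ => by ring
    _ ≤ s ^ (2 * p) * (2 * p).factorial * (2 ^ S.card * 2) := by gcongr
    _ = _ := by
        rw [pow_mul, hs2]
        ring

lemma sum_norm_signSum_pow_le (S : Finset ι) {z : ι → ℂ} (hz : ∀ k, ‖z k‖ ≤ 1) (p : ℕ) :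
    ∑ T ∈ S.powerset, ‖∑ k ∈ S, (if k ∈ T then 1 else -1) * z k‖ ^ (2 * p) ≤
      2 ^ S.card * (2 ^ p * (4 * (2 * p).factorial) * (S.card : ℝ) ^ p) := by
  have hre : ∀ T, (∑ k ∈ S, (if k ∈ T then 1 else -1) * z k).re =
      signSum S T fun k => (z k).re := by
    intro T
    rw [Complex.re_sum, signSum]
    exact Finset.sum_congr rfl fun k _ => by split_ifs <;> simp
  have him : ∀ T, (∑ k ∈ S, (if k ∈ T then 1 else -1) * z k).im =
      signSum S T fun k => (z k).im := by
    intro T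
    rw [Complex.im_sum, signSum]
    exact Finset.sum_congr rfl fun k _ => by split_ifs <;> simp
  have h1 := sum_signSum_pow_le S (a := fun k => (z k).re)
    (fun k => (Complex.abs_re_le_norm _).trans (hz k)) p
  have h2 := sum_signSum_pow_le S (a := fun k => (z k).im)
    (fun k => (Complex.abs_im_le_norm _).trans (hz k)) p
  calc _ ≤ ∑ T ∈ S.powerset, 2 ^ p * (signSum S T (fun k => (z k).re) ^ (2 * p) +
        signSum S T (fun k => (z k).im) ^ (2 * p)) := by
        refine Finset.sum_le_sum fun T _ => ?_
        rw [pow_mul, Complex.sq_norm, Complex.normSq_apply, hre, him, ← sq, ← sq, pow_mul, pow_mul]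
        refine (add_pow_le (sq_nonneg _) (sq_nonneg _) p).trans ?_
        gcongr
        · norm_num
        · omega
    _ = 2 ^ p * (∑ T ∈ S.powerset, signSum S T (fun k => (z k).re) ^ (2 * p) +
        ∑ T ∈ S.powerset, signSum S T (fun k => (z k).im) ^ (2 * p)) := by
        rw [← Finset.sum_add_distrib, Finset.mul_sum]
    _ ≤ 2 ^ p * (2 ^ S.card * (2 * (2 * p).factorial * (S.card : ℝ) ^ p) +
        2 ^ S.card * (2 * (2 * p).factorial * (S.card : ℝ) ^ p)) := by gcongr
    _ = _ := by ring

end Rademacher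

/-! ### Signings of characters in `L_q`, `q < ∞` -/

/-- The `L_q` norm of the trigonometric polynomial with coefficients `c` and frequencies in `B`. -/
def trigSeminorm (d : ℕ) (q : ℝ≥0∞) (hq : 1 ≤ q) (B : Finset (Fin d → ℤ)) :
    Seminorm ℂ ((Fin d → ℤ) → ℂ) :=
  Seminorm.of (fun c => (LqNorm d q fun x => ∑ k ∈ B, c k * expk d k x).toReal)
    (fun c c' => by
      have h1 := memLp_trigSum d q B c
      have h2 := memLp_trigSum d q B c'
      simp only [LqNorm]
      rw [← ENNReal.toReal_add h1.2.ne h2.2.ne]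
      refine ENNReal.toReal_mono (ENNReal.add_ne_top.2 ⟨h1.2.ne, h2.2.ne⟩) ?_
      refine le_trans (le_of_eq ?_) (eLpNorm_add_le h1.1 h2.1 hq)
      congr 1
      funext x
      simp [add_mul, Finset.sum_add_distrib])
    (fun a c => by
      have : (fun x => ∑ k ∈ B, (a • c) k * expk d k x) =
          a • fun x => ∑ k ∈ B, c k * expk d k x := by
        funext x
        simp [Finset.mul_sum, mul_assoc]
      rw [this, LqNorm, eLpNorm_const_smul, ENNReal.toReal_mul, LqNorm]
      simp)

lemma trigSeminorm_apply (d : ℕ) (q : ℝ≥0∞) (hq : 1 ≤ q) (B : Finset (Fin d → ℤ))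
    (c : (Fin d → ℤ) → ℂ) :
    trigSeminorm d q hq B c = (LqNorm d q fun x => ∑ k ∈ B, c k * expk d k x).toReal := rfl

lemma trigSeminorm_le_of_forall_norm_le {d : ℕ} {q : ℝ≥0∞} (hq : 1 ≤ q) {B : Finset (Fin d → ℤ)}
    {c : (Fin d → ℤ) → ℂ} {M : ℝ} (hM : 0 ≤ M) (h : ∀ x, ‖∑ k ∈ B, c k * expk d k x‖ ≤ M) :
    trigSeminorm d q hq B c ≤ M := by
  rw [trigSeminorm_apply]
  refine ENNReal.toReal_le_of_le_ofReal hM ?_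
  refine (eLpNorm_le_of_ae_bound (Filter.Eventually.of_forall h)).trans ?_
  simp

lemma trigSeminorm_le_sum (d : ℕ) (q : ℝ≥0∞) (hq : 1 ≤ q) (B : Finset (Fin d → ℤ))
    (c : (Fin d → ℤ) → ℂ) : trigSeminorm d q hq B c ≤ ∑ k ∈ B, ‖c k‖ :=
  trigSeminorm_le_of_forall_norm_le hq (Finset.sum_nonneg fun _ _ => norm_nonneg _)
    (norm_trigSum_le d B c)

lemma sum_signVec {d : ℕ} {B S : Finset (Fin d → ℤ)} (hS : S ⊆ B) (T : Finset (Fin d → ℤ))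
    (x : Fin d → ℝ) : ∑ k ∈ B, signVec S T k * expk d k x =
      ∑ k ∈ S, (if k ∈ T then 1 else -1) * expk d k x := by
  rw [← Finset.sum_subset hS]
  · exact Finset.sum_congr rfl fun k hk => by rw [signVec, if_pos hk]
  · intro k _ hk
    rw [signVec, if_neg hk, zero_mul]

lemma exists_hasSigning_of_ne_top (d : ℕ) {q : ℝ≥0∞} (hq : 1 ≤ q) (hq' : q ≠ ∞) :
    ∃ A : ℝ, 1 ≤ A ∧ ∀ B, HasSigning (trigSeminorm d q hq B) B A (1 / 2) := by
  obtain ⟨p, hp⟩ := exists_nat_ge (q.toReal)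
  have hqp : q ≤ ((2 * (p + 1) : ℕ) : ℝ≥0∞) := by
    rw [← ENNReal.ofReal_toReal hq', ← ENNReal.ofReal_natCast]
    refine ENNReal.ofReal_le_ofReal ?_
    push_cast
    linarith [(p.cast_nonneg : (0:ℝ) ≤ p)]
  set P := p + 1 with hP
  set C : ℝ := 2 ^ P * (4 * (2 * P).factorial) with hC
  have hP0 : (0:ℝ) < (2 * P : ℕ) := by exact_mod_cast (by omega : 0 < 2 * P)
  refine ⟨max (C ^ ((2 * P : ℕ) : ℝ)⁻¹) 1, le_max_right _ _, fun B S hS => ?_⟩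
  set F : Finset (Fin d → ℤ) → (Fin d → ℝ) → ℂ := fun T x =>
    ∑ k ∈ S, (if k ∈ T then 1 else -1) * expk d k x with hF
  have hmem : ∀ T (q : ℝ≥0∞), MemLp (F T) q (cubeMeasure d) := fun T q => memLp_trigSum d q S _
  have hφint : ∀ T, Integrable (fun x => ‖F T x‖ ^ (2 * P)) (cubeMeasure d) := fun T =>
    (hmem T _).integrable_norm_pow (by omega)
  obtain ⟨T, hT, hTle⟩ : ∃ T ∈ S.powerset,
      ∫ x, ‖F T x‖ ^ (2 * P) ∂(cubeMeasure d) ≤ C * (S.card : ℝ) ^ P := by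
    refine Finset.exists_le_of_sum_le ⟨∅, Finset.empty_mem_powerset S⟩ ?_
    rw [Finset.sum_const, Finset.card_powerset, nsmul_eq_mul, ← integral_finsetSum _ fun T _ => hφint T]
    have hb : ∀ x, ∑ T ∈ S.powerset, ‖F T x‖ ^ (2 * P) ≤ 2 ^ S.card * (C * (S.card : ℝ) ^ P) :=
      fun x => sum_norm_signSum_pow_le S (z := fun k => expk d k x)
        (fun k => (norm_expk d k x).le) P
    refine (integral_mono (integrable_finsetSum _ fun T _ => hφint T) (integrable_const _) hb).trans ?_
    simp
  refine ⟨T, Finset.mem_powerset.1 hT, ?_⟩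
  rw [trigSeminorm_apply]
  simp_rw [sum_signVec hS]
  refine ENNReal.toReal_le_of_le_ofReal (by positivity) ?_
  refine (eLpNorm_le_eLpNorm_of_exponent_le hqp (hmem T 1).1).trans ?_
  rw [(hmem T _).eLpNorm_eq_integral_rpow_norm (by simp [hP]) (ENNReal.natCast_ne_top _)]
  refine ENNReal.ofReal_le_ofReal ?_
  rw [ENNReal.toReal_natCast]
  simp_rw [Real.rpow_natCast]
  calc _ ≤ (C * (S.card : ℝ) ^ P) ^ ((2 * P : ℕ) : ℝ)⁻¹ := by
        refine Real.rpow_le_rpow (integral_nonneg fun x => by positivity) hTle (by positivity)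
    _ = C ^ ((2 * P : ℕ) : ℝ)⁻¹ * (S.card : ℝ) ^ (1 / 2 : ℝ) := by
        rw [Real.mul_rpow (by positivity) (by positivity), ← Real.rpow_natCast (S.card : ℝ) P,
          ← Real.rpow_mul (by positivity)]
        congr 2
        push_cast
        rw [mul_inv]
        have : (P : ℝ) ≠ 0 := by
          rw [hP]
          positivity
        field_simp
    _ ≤ _ := by
        gcongr
        exact le_max_left _ _

/-! ### Partial colouring by the pigeonhole principle -/

section Colouring

variable {ι κ : Type*} [DecidableEq ι]

lemma abs_round_le_pow (y : ℝ) {p : ℕ} (hp : 1 ≤ p) : |(round y : ℝ)| ≤ (2 * y) ^ (2 * p) := by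
  by_cases h : round y = 0
  · rw [h, pow_mul]
    simp only [Int.cast_zero, abs_zero]
    positivity
  · have h1 : (1:ℝ) ≤ |(round y : ℝ)| := by exact_mod_cast Int.one_le_abs h
    have h2 := abs_sub_round y
    have h3 : |(round y : ℝ)| ≤ |y| + |y - round y| := by
      have := abs_sub_abs_le_abs_sub (round y : ℝ) y
      rw [abs_sub_comm] at this
      linarith
    have h4 : (1:ℝ) ≤ |2 * y| := by
      rw [abs_mul, abs_two]
      linarith
    calc |(round y : ℝ)| ≤ |2 * y| ^ 1 := by
          rw [abs_mul, abs_two]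
          linarith
      _ ≤ |2 * y| ^ (2 * p) := pow_le_pow_right₀ h4 (by omega)
      _ = (2 * y) ^ (2 * p) := by rw [pow_mul, pow_mul, sq_abs]

lemma sum_pow_natAbs_le {x : ℝ} (hx : 0 ≤ x) (hx' : x ≤ 1 / 2) (V : Finset ℤ) :
    ∑ v ∈ V, x ^ v.natAbs ≤ Real.exp (4 * x) := by
  have h0 := hasSum_geometric_of_lt_one hx (by linarith)
  have h : HasSum (fun v : ℤ => x ^ v.natAbs) ((1 - x)⁻¹ + (1 - x)⁻¹ * x) := by
    refine HasSum.of_nat_of_neg_add_one (by simpa using h0) ?_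
    refine (h0.mul_right x).congr_fun fun n => ?_
    have : (-((n:ℤ) + 1)).natAbs = n + 1 := by omega
    rw [this, pow_succ]
  refine (sum_le_hasSum V (fun _ _ => by positivity) h).trans ?_
  refine le_trans ?_ (Real.add_one_le_exp _)
  have h1 : (0:ℝ) < 1 - x := by linarith
  rw [← mul_one_add, ← div_eq_inv_mul, div_le_iff₀ h1]
  nlinarith

lemma card_filter_card_lt_le {ι : Type*} (S : Finset ι) :
    (((S.powerset.filter fun U => 16 * U.card < S.card).card : ℕ) : ℝ) ≤
      (13 / 10 : ℝ) ^ S.card := by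
  set n := S.card with hn
  have h1 : ∑ U ∈ S.powerset, (1 / 16 : ℝ) ^ U.card = (17 / 16) ^ n := by
    have := Finset.sum_pow_mul_eq_add_pow (1 / 16 : ℝ) 1 S
    simp only [one_pow, mul_one] at this
    rw [this, ← hn]
    norm_num
  have h2 : (((S.powerset.filter fun U => 16 * U.card < n).card : ℕ) : ℝ) *
      (1 / 16 : ℝ) ^ ((n : ℝ) / 16) ≤ (17 / 16) ^ n := by
    rw [← h1, ← nsmul_eq_mul]
    refine (Finset.card_nsmul_le_sum _ (fun U => (1 / 16 : ℝ) ^ U.card) _ fun U hU => ?_).trans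
      (Finset.sum_le_sum_of_subset_of_nonneg (Finset.filter_subset _ _) fun _ _ _ => by positivity)
    rw [← Real.rpow_natCast]
    refine Real.rpow_le_rpow_of_exponent_ge (by norm_num) (by norm_num) ?_
    have := (Finset.mem_filter.1 hU).2
    rw [le_div_iff₀ (by norm_num)]
    have : ((16 * U.card : ℕ) : ℝ) < n := by exact_mod_cast this
    push_cast at this
    linarith
  have h3 : (1 / 16 : ℝ) ^ ((n : ℝ) / 16) = ((1 / 2 : ℝ) ^ (1 / 4 : ℝ)) ^ n := by
    rw [← Real.rpow_natCast, ← Real.rpow_mul (by norm_num),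
      show (1 / 16 : ℝ) = (1 / 2) ^ (4 : ℝ) by norm_num, ← Real.rpow_mul (by norm_num)]
    congr 1
    ring
  have h4 : (5 / 6 : ℝ) ≤ (1 / 2 : ℝ) ^ (1 / 4 : ℝ) := by
    have : (5 / 6 : ℝ) = ((5 / 6 : ℝ) ^ (4 : ℝ)) ^ (1 / 4 : ℝ) := by
      rw [← Real.rpow_mul (by norm_num)]
      norm_num
    rw [this]
    gcongr
    norm_num
  rw [h3] at h2
  have h5 : (5 / 6 : ℝ) ^ n ≤ ((1 / 2 : ℝ) ^ (1 / 4 : ℝ)) ^ n := by gcongr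
  have h6 : (13 / 10 : ℝ) ^ n * (5 / 6) ^ n ≥ (17 / 16) ^ n := by
    rw [← mul_pow]
    refine pow_le_pow_left₀ (by norm_num) (by norm_num) _
  have h7 : (0:ℝ) < (5 / 6) ^ n := by positivity
  refine le_of_mul_le_mul_right ?_ h7
  refine le_trans ?_ h6
  refine le_trans ?_ h2
  gcongr

variable [Fintype κ]

lemma exists_partial_colouring_of_sum_le (S : Finset ι) (b : κ → Finset ι → ℤ) {M : ℝ}
    (hS : S.Nonempty) (hM : (S.card : ℝ) ≤ M) (hκ : (Fintype.card κ : ℝ) ≤ M)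
    (hb : ∑ T ∈ S.powerset, ∑ j, |(b j T : ℝ)| ≤
      2 ^ S.card * ((1 / 20) ^ 2 * (S.card : ℝ) ^ 2 / M)) :
    ∃ T₁ ⊆ S, ∃ T₂ ⊆ S, S.card ≤ 16 * (symmDiff T₁ T₂).card ∧ ∀ j, b j T₁ = b j T₂ := by
  classical
  by_contra! hcon
  set n := S.card with hn
  have hn0 : (0:ℝ) < n := by exact_mod_cast hS.card_pos
  have hM0 : 0 < M := hn0.trans_le hM
  set x : ℝ := 1 / 20 * n / M with hx
  have hx0 : 0 < x := by positivity
  have hx1 : x ≤ 1 / 20 := by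
    rw [hx, div_le_iff₀ hM0]
    linarith
  set β : Finset ι → κ → ℤ := fun T j => b j T with hβ
  set H : ℝ := (13 / 10 : ℝ) ^ n with hH
  have hfib : ∀ β₀, (((S.powerset.filter fun T => β T = β₀).card : ℕ) : ℝ) ≤ H := by
    intro β₀
    rcases (S.powerset.filter fun T => β T = β₀).eq_empty_or_nonempty with h | ⟨T₀, hT₀⟩
    · rw [h]
      simp only [Finset.card_empty, Nat.cast_zero]
      positivity
    · refine le_trans ?_ (card_filter_card_lt_le S)
      norm_cast
      obtain ⟨hT₀S, hT₀β⟩ := Finset.mem_filter.1 hT₀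
      rw [Finset.mem_powerset] at hT₀S
      refine Finset.card_le_card_of_injOn (fun T => symmDiff T₀ T) ?_
        (fun T _ T' _ h => symmDiff_right_injective T₀ h)
      intro T hT
      obtain ⟨hTS, hTβ⟩ := Finset.mem_filter.1 hT
      rw [Finset.mem_powerset] at hTS
      refine Finset.mem_coe.2 (Finset.mem_filter.2 ⟨Finset.mem_powerset.2 ?_, ?_⟩)
      · exact (symmDiff_le_sup (a := T₀) (b := T)).trans (sup_le hT₀S hTS)
      · by_contra! hge
        obtain ⟨j, hj⟩ := hcon T₀ hT₀S T hTS hge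
        exact hj (congrFun (hT₀β.trans hTβ.symm) j)
  have hup : ∑ T ∈ S.powerset, ∏ j, x ^ (b j T).natAbs ≤ H * Real.exp (n / 5) := by
    set L : Finset ℤ := (S.powerset ×ˢ Finset.univ).image fun w => b w.2 w.1 with hL
    have hmaps : ∀ T ∈ S.powerset, β T ∈ Fintype.piFinset fun _ : κ => L := by
      intro T hT
      rw [Fintype.mem_piFinset]
      exact fun j => Finset.mem_image.2 ⟨(T, j), Finset.mk_mem_product hT (Finset.mem_univ _), rfl⟩
    rw [← Finset.sum_fiberwise_of_maps_to hmaps]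
    calc _ ≤ ∑ β₀ ∈ Fintype.piFinset fun _ : κ => L, H * ∏ j, x ^ (β₀ j).natAbs := by
          refine Finset.sum_le_sum fun β₀ _ => ?_
          rw [Finset.sum_congr rfl fun T hT => by
            rw [show ∏ j, x ^ (b j T).natAbs = ∏ j, x ^ (β₀ j).natAbs by
              rw [← (Finset.mem_filter.1 hT).2]], Finset.sum_const, nsmul_eq_mul]
          exact mul_le_mul_of_nonneg_right (hfib β₀)
            (Finset.prod_nonneg fun _ _ => by positivity)
      _ = H * ∏ _j : κ, ∑ v ∈ L, x ^ v.natAbs := by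
          rw [← Finset.mul_sum, Finset.prod_univ_sum]
      _ ≤ H * Real.exp (n / 5) := by
          refine mul_le_mul_of_nonneg_left ?_ (by positivity)
          refine (Finset.prod_le_prod (fun _ _ => Finset.sum_nonneg fun _ _ => by positivity)
            fun _ _ => sum_pow_natAbs_le hx0.le (by linarith) L).trans ?_
          rw [Finset.prod_const, ← Real.exp_nat_mul, Finset.card_univ]
          refine Real.exp_le_exp.2 ?_
          have : (Fintype.card κ : ℝ) * (4 * x) ≤ M * (4 * x) := by gcongr
          refine this.trans (le_of_eq ?_)
          rw [hx]
          field_simp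
          norm_num
  have hlow : (2:ℝ) ^ n * Real.exp (-(n / 20)) ≤ ∑ T ∈ S.powerset, ∏ j, x ^ (b j T).natAbs := by
    set l : ℝ := -Real.log x with hl
    have hl0 : 0 ≤ l := by
      have := Real.log_nonpos hx0.le (by linarith)
      linarith
    set u : Finset ι → ℝ := fun T => ∑ j, |(b j T : ℝ)| with hu
    have hprod : ∀ T, ∏ j, x ^ (b j T).natAbs = Real.exp (-(l * u T)) := by
      intro T
      rw [Finset.prod_pow_eq_pow_sum, ← Real.exp_log (pow_pos hx0 _), Real.log_pow, hu, hl]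
      simp only [Nat.cast_sum, Nat.cast_natAbs, Int.cast_abs]
      congr 1
      ring
    set s : ℝ := (1 / 20) ^ 2 * (n : ℝ) ^ 2 / M with hs
    have hls : l * s ≤ n / 20 := by
      have h1 : l ≤ x⁻¹ := by
        have := Real.log_le_self (inv_nonneg.2 hx0.le)
        rwa [Real.log_inv] at this
      have h2 : 0 ≤ s := by positivity
      refine (mul_le_mul_of_nonneg_right h1 h2).trans (le_of_eq ?_)
      rw [hx, hs]
      field_simp
    calc (2:ℝ) ^ n * Real.exp (-(n / 20)) ≤ 2 ^ n * Real.exp (-(l * s)) := by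
          gcongr
      _ ≤ Real.exp (-(l * s)) * (2 ^ n + l * (2 ^ n * s - ∑ T ∈ S.powerset, u T)) := by
          have := mul_nonneg hl0 (sub_nonneg.2 hb)
          nlinarith [Real.exp_pos (-(l * s))]
      _ = ∑ T ∈ S.powerset, Real.exp (-(l * s)) * (1 + l * (s - u T)) := by
          rw [← Finset.mul_sum, Finset.sum_add_distrib, ← Finset.mul_sum, Finset.sum_sub_distrib]
          simp [Finset.card_powerset, hn]
      _ ≤ _ := by
          refine Finset.sum_le_sum fun T _ => ?_
          rw [hprod, show -(l * u T) = -(l * s) + l * (s - u T) by ring, Real.exp_add]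
          gcongr
          linarith [Real.add_one_le_exp (l * (s - u T))]
  have hfin := hlow.trans hup
  have h1 : (2:ℝ) ^ n ≤ (13 / 10 * Real.exp (1 / 4)) ^ n := by
    have h2 : Real.exp (n / 5) * Real.exp (n / 20) = Real.exp (1 / 4) ^ n := by
      rw [← Real.exp_add, ← Real.exp_nat_mul]
      congr 1
      ring
    have h3 := mul_le_mul_of_nonneg_right hfin (Real.exp_pos (n / 20)).le
    rw [mul_assoc, ← Real.exp_add, neg_add_cancel, Real.exp_zero, mul_one, mul_assoc, h2] at h3
    rwa [mul_pow]
  have h4 : Real.exp (1 / 4) < 4 / 3 := by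
    have h5 : Real.exp (1 / 4) ^ 4 = Real.exp 1 := by
      rw [← Real.exp_nat_mul]
      norm_num
    by_contra! h6
    have h7 : (4 / 3 : ℝ) ^ 4 ≤ Real.exp (1 / 4) ^ 4 := by gcongr
    have := Real.exp_one_lt_d9
    rw [h5] at h7
    norm_num at h7
    linarith
  have h8 : (13 / 10 * Real.exp (1 / 4)) ^ n < 2 ^ n := by
    refine pow_lt_pow_left₀ (by linarith) (by positivity) ?_
    exact hS.card_pos.ne'
  linarith

lemma exists_partial_colouring {δ : ℝ} (hδ : 0 < δ) :
    ∃ K : ℝ, 1 ≤ K ∧ ∀ {ι κ : Type} [DecidableEq ι] [Fintype κ] (S : Finset ι)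
      (a : κ → ι → ℝ) (M : ℝ), (∀ j k, |a j k| ≤ 1) → S.Nonempty → (S.card : ℝ) ≤ M →
      (Fintype.card κ : ℝ) ≤ M →
      ∃ T₁ ⊆ S, ∃ T₂ ⊆ S, S.card ≤ 16 * (symmDiff T₁ T₂).card ∧
        ∀ j, |signSum S T₁ (a j) - signSum S T₂ (a j)| ≤ K * (S.card : ℝ) ^ (1 / 2 - δ) * M ^ δ := by
  obtain ⟨p, hp⟩ := exists_nat_ge (1 / δ)
  have hpδ : 1 ≤ p * δ := by rwa [div_le_iff₀ hδ] at hp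
  have hp1 : 1 ≤ p := by
    rcases p.eq_zero_or_pos with rfl | h
    · norm_num at hpδ
    · exact h
  set C : ℝ := 2 ^ (2 * p) * (2 * (2 * p).factorial) * 400 with hC
  refine ⟨max C 1, le_max_right _ _, fun {ι κ} _ _ S a M ha hS hM hκ => ?_⟩
  set K := max C 1 with hK
  have hK1 : 1 ≤ K := le_max_right _ _
  have hKC : C ≤ K ^ (2 * p) := (le_max_left _ _).trans (le_self_pow₀ hK1 (by omega))
  set n := S.card with hn
  have hn0 : (0:ℝ) < n := by exact_mod_cast hS.card_pos
  have hM0 : 0 < M := hn0.trans_le hM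
  set D : ℝ := K * (n : ℝ) ^ (1 / 2 - δ) * M ^ δ with hD
  have hD0 : 0 < D := by positivity
  have hDp : C * (n : ℝ) ^ p * M ^ 2 ≤ D ^ (2 * p) * n ^ 2 := by
    have e1 : D ^ (2 * p) * n ^ 2 = K ^ (2 * p) * (n : ℝ) ^ p * ((M / n) ^ (2 * (p * δ)) * n ^ 2) := by
      rw [hD, mul_pow, mul_pow, ← Real.rpow_natCast (_ ^ (1 / 2 - δ)), ← Real.rpow_mul hn0.le,
        ← Real.rpow_natCast (_ ^ δ), ← Real.rpow_mul hM0.le, Real.div_rpow hM0.le hn0.le,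
        ← Real.rpow_natCast (n : ℝ) p]
      have : (n : ℝ) ^ ((1 / 2 - δ) * ((2 * p : ℕ) : ℝ)) = (n : ℝ) ^ (p : ℝ) / n ^ (2 * (p * δ)) := by
        rw [← Real.rpow_sub hn0]
        congr 1
        push_cast
        ring
      rw [this, show δ * ((2 * p : ℕ) : ℝ) = 2 * (p * δ) by push_cast; ring]
      ring
    have e2 : (M / n) ^ 2 ≤ (M / n) ^ (2 * (p * δ)) := by
      rw [← Real.rpow_natCast]
      refine Real.rpow_le_rpow_of_exponent_le ((one_le_div hn0).2 hM) ?_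
      push_cast
      linarith
    have e3 : M ^ 2 = (M / n) ^ 2 * n ^ 2 := by
      field_simp
    rw [e1, e3]
    gcongr
  obtain ⟨T₁, h₁, T₂, h₂, hc, hb⟩ := exists_partial_colouring_of_sum_le S
    (fun j T => round (signSum S T (a j) / D)) hS hM hκ (by
      rw [Finset.sum_comm]
      have e : ∀ j, ∑ T ∈ S.powerset, |(round (signSum S T (a j) / D) : ℝ)| ≤
          2 ^ n * ((1 / 20) ^ 2 * (n : ℝ) ^ 2 / M ^ 2) := by
        intro j
        have e0 := sum_signSum_pow_le S (ha j) p
        calc _ ≤ ∑ T ∈ S.powerset, (2 * (signSum S T (a j) / D)) ^ (2 * p) :=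
              Finset.sum_le_sum fun T _ => abs_round_le_pow _ hp1
          _ = 2 ^ (2 * p) / D ^ (2 * p) * ∑ T ∈ S.powerset, signSum S T (a j) ^ (2 * p) := by
              rw [Finset.mul_sum]
              refine Finset.sum_congr rfl fun T _ => ?_
              rw [mul_pow, div_pow]
              ring
          _ ≤ 2 ^ (2 * p) / D ^ (2 * p) *
              (2 ^ n * (2 * (2 * p).factorial * (n : ℝ) ^ p)) := by gcongr
          _ = 2 ^ n * (C * (n : ℝ) ^ p / D ^ (2 * p) / 400) := by
              rw [hC]
              ring
          _ ≤ 2 ^ n * (n ^ 2 / M ^ 2 / 400) := by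
              have : C * (n : ℝ) ^ p / D ^ (2 * p) ≤ n ^ 2 / M ^ 2 := by
                rw [div_le_div_iff₀ (by positivity) (by positivity)]
                linarith
              gcongr
          _ = _ := by ring
      refine (Finset.sum_le_sum fun j _ => e j).trans ?_
      rw [Finset.sum_const, nsmul_eq_mul, Finset.card_univ]
      refine (mul_le_mul_of_nonneg_right hκ (by positivity)).trans (le_of_eq ?_)
      field_simp
      rfl)
  refine ⟨T₁, h₁, T₂, h₂, hc, fun j => ?_⟩
  have r1 := abs_sub_round (signSum S T₁ (a j) / D)
  have r2 := abs_sub_round (signSum S T₂ (a j) / D)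
  rw [← hb j] at r2
  rw [abs_le] at r1 r2
  have r3 : |signSum S T₁ (a j) / D - signSum S T₂ (a j) / D| ≤ 1 := by
    rw [abs_le]
    constructor <;> linarith
  rwa [← sub_div, abs_div, abs_of_pos hD0, div_le_one hD0] at r3

lemma exists_colouring {δ : ℝ} (hδ : 0 < δ) (hδ' : δ < 1 / 2) :
    ∃ K : ℝ, 1 ≤ K ∧ ∀ {ι κ : Type} [DecidableEq ι] [Fintype κ] (S : Finset ι)
      (a : κ → ι → ℝ) (M : ℝ), (∀ j k, |a j k| ≤ 1) → (S.card : ℝ) ≤ M →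
      (Fintype.card κ : ℝ) ≤ M →
      ∃ T ⊆ S, ∀ j, |signSum S T (a j)| ≤ K * (S.card : ℝ) ^ (1 / 2 - δ) * M ^ δ := by
  obtain ⟨K, hK, h⟩ := exists_partial_colouring hδ
  set α := 1 / 2 - δ with hα
  have hα0 : 0 < α := by linarith
  set γ : ℝ := (15 / 16 : ℝ) ^ α with hγ
  have hγ1 : γ < 1 := Real.rpow_lt_one (by norm_num) (by norm_num) hα0
  have hγ0 : 0 ≤ γ := by positivity
  have hK0 : K ≤ K / (1 - γ) := by
    rw [le_div_iff₀ (by linarith)]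
    nlinarith
  refine ⟨K / (1 - γ), hK.trans hK0, fun {ι κ} _ _ S a M ha => ?_⟩
  induction S using Finset.strongInduction with
  | H S ih =>
    intro hM hκ
    rcases S.eq_empty_or_nonempty with rfl | hS
    · refine ⟨∅, Finset.Subset.refl _, fun j => ?_⟩
      have hM' : 0 ≤ M := (by positivity : (0:ℝ) ≤ (Finset.card (∅ : Finset ι) : ℝ)).trans hM
      have : 0 ≤ K / (1 - γ) := by linarith
      simp only [signSum, Finset.sum_empty, abs_zero]
      positivity
    have hM' : 0 ≤ M := (by positivity : (0:ℝ) ≤ (S.card : ℝ)).trans hM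
    obtain ⟨T₁, h₁, T₂, h₂, hc, hd⟩ := h S a M ha hS hM hκ
    set U := symmDiff T₁ T₂ with hU
    have hUS : U ⊆ S := (symmDiff_le_sup (a := T₁) (b := T₂)).trans (sup_le h₁ h₂)
    have hU0 : U.Nonempty := by
      rw [← Finset.card_pos]
      have := hS.card_pos
      omega
    have hcard : (S \ U).card + U.card = S.card := Finset.card_sdiff_add_card_eq_card hUS
    have hcR : ((S \ U).card : ℝ) ≤ 15 / 16 * S.card := by
      have h1 : ((S \ U).card : ℝ) + U.card = S.card := by exact_mod_cast hcard
      have h2 : (S.card : ℝ) ≤ 16 * U.card := by exact_mod_cast hc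
      linarith
    obtain ⟨T', hT', hd'⟩ := ih (S \ U)
      (Finset.sdiff_ssubset hUS hU0) (hcR.trans (by linarith)) hκ
    refine ⟨T' ∪ (T₁ \ T₂), Finset.union_subset (hT'.trans Finset.sdiff_subset)
      (Finset.sdiff_subset.trans h₁), fun j => ?_⟩
    have key : signSum S (T' ∪ (T₁ \ T₂)) (a j) = signSum (S \ U) T' (a j) +
        (signSum S T₁ (a j) - signSum S T₂ (a j)) / 2 := by
      simp only [signSum]
      rw [← Finset.sum_sub_distrib, Finset.sum_div, ← Finset.sum_sdiff hUS, ← Finset.sum_sdiff hUS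
        (f := fun k => ((if k ∈ T₁ then 1 else -1) * a j k - (if k ∈ T₂ then 1 else -1) * a j k) / 2),
        ← add_assoc, ← Finset.sum_add_distrib]
      congr 1
      · refine Finset.sum_congr rfl fun k hk => ?_
        have hk' := (Finset.mem_sdiff.1 hk).2
        rw [hU, Finset.mem_symmDiff] at hk'
        have h12 : k ∈ T₁ ↔ k ∈ T₂ := by tauto
        by_cases k2 : k ∈ T₂ <;> simp [h12, k2]
      · refine Finset.sum_congr rfl fun k hk => ?_
        have hk0 : k ∉ T' := fun h => (Finset.mem_sdiff.1 (hT' h)).2 hk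
        rw [hU, Finset.mem_symmDiff] at hk
        rcases hk with ⟨k1, k2⟩ | ⟨k1, k2⟩
        · simp [k1, k2]
        · simp only [Finset.mem_union, Finset.mem_sdiff, hk0, k1, k2]
          norm_num
          ring
    rw [key]
    have b1 := hd' j
    have b2 := hd j
    have b3 : ((S \ U).card : ℝ) ^ α ≤ γ * (S.card : ℝ) ^ α := by
      rw [hγ, ← Real.mul_rpow (by norm_num) (by positivity)]
      gcongr
    set N := (S.card : ℝ) ^ α
    have hN : 0 ≤ N := by positivity
    have hMδ : 0 ≤ M ^ δ := by positivity
    calc _ ≤ |signSum (S \ U) T' (a j)| + |(signSum S T₁ (a j) - signSum S T₂ (a j)) / 2| :=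
          abs_add_le _ _
      _ ≤ K / (1 - γ) * (γ * N) * M ^ δ + K * N * M ^ δ := by
          refine add_le_add (b1.trans ?_) ?_
          · have : 0 ≤ K / (1 - γ) := by linarith
            gcongr
          · rw [abs_div, abs_two]
            have := abs_nonneg (signSum S T₁ (a j) - signSum S T₂ (a j))
            linarith
      _ = K / (1 - γ) * N * M ^ δ := by
          have : 1 - γ ≠ 0 := by linarith
          field_simp
          ring

end Colouring

/-! ### Signings of characters in `L_∞` on the one-dimensional torus -/

/-- The character `x ↦ e^{2π i n x}` of the circle. -/
def circleChar (n : ℤ) (x : ℝ) : ℂ := Complex.exp (((2 * π * (n * x) : ℝ) : ℂ) * Complex.I)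

lemma expk_one (k : Fin 1 → ℤ) (x : Fin 1 → ℝ) : expk 1 k x = circleChar (k 0) (x 0) := by
  rw [expk, circleChar, Fin.sum_univ_one]

lemma norm_circleChar (n : ℤ) (x : ℝ) : ‖circleChar n x‖ = 1 := Complex.norm_exp_ofReal_mul_I _

lemma circleChar_add (m n : ℤ) (x : ℝ) :
    circleChar (m + n) x = circleChar m x * circleChar n x := by
  rw [circleChar, circleChar, circleChar, ← Complex.exp_add]
  congr 1
  push_cast
  ring

lemma circleChar_zero (x : ℝ) : circleChar 0 x = 1 := by simp [circleChar]

lemma conj_circleChar (n : ℤ) (x : ℝ) :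
    (starRingEnd ℂ) (circleChar n x) = circleChar (-n) x := by
  rw [circleChar, circleChar, ← Complex.exp_conj, map_mul, Complex.conj_I, Complex.conj_ofReal]
  congr 1
  push_cast
  ring

lemma circleChar_sub_arg (n : ℤ) (x y : ℝ) :
    circleChar n (x - y) = circleChar n x * circleChar (-n) y := by
  rw [circleChar, circleChar, circleChar, ← Complex.exp_add]
  congr 1
  push_cast
  ring

lemma sum_circleChar_grid {L : ℕ} (hL : 0 < L) (n : ℤ) :
    ∑ j ∈ Finset.range L, circleChar n ((j : ℝ) / L) = if (L : ℤ) ∣ n then (L : ℂ) else 0 := by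
  have hL' : (L : ℂ) ≠ 0 := by exact_mod_cast hL.ne'
  set ζ := circleChar n (1 / L) with hζ
  have hpow : ∀ j : ℕ, circleChar n ((j : ℝ) / L) = ζ ^ j := by
    intro j
    rw [hζ, circleChar, circleChar, ← Complex.exp_nat_mul]
    congr 1
    push_cast
    ring
  simp_rw [hpow]
  have hζ1 : ζ = 1 ↔ (L : ℤ) ∣ n := by
    rw [hζ, circleChar, Complex.exp_eq_one_iff]
    have hpi : (π : ℂ) ≠ 0 := by exact_mod_cast Real.pi_ne_zero
    constructor
    · rintro ⟨z, hz⟩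
      refine ⟨z, ?_⟩
      push_cast at hz
      field_simp at hz
      exact_mod_cast hz
    · rintro ⟨z, rfl⟩
      refine ⟨z, ?_⟩
      push_cast
      field_simp
  split_ifs with h
  · rw [hζ1.2 h]
    simp
  · have h1 : ζ ≠ 1 := fun h' => h (hζ1.1 h')
    rw [geom_sum_eq h1, ← hpow L, div_self (by exact_mod_cast hL.ne')]
    have : circleChar n 1 = 1 := by
      rw [circleChar, Complex.exp_eq_one_iff]
      exact ⟨n, by push_cast; ring⟩
    rw [this, sub_self, zero_div]

/-- The Dirichlet-type kernel `∑_{0 ≤ a < n} e^{2π i a x}`. -/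
def halfDirichlet (n : ℕ) (x : ℝ) : ℂ := ∑ a ∈ Finset.range n, circleChar a x

lemma sum_normSq_halfDirichlet {L n : ℕ} (hL : 0 < L) (hn : n ≤ L) (x : ℝ) :
    ∑ j ∈ Finset.range L, ‖halfDirichlet n (x - (j : ℝ) / L)‖ ^ 2 = L * n := by
  have h : ∀ y, ((‖halfDirichlet n y‖ ^ 2 : ℝ) : ℂ) =
      ∑ a ∈ Finset.range n, ∑ b ∈ Finset.range n, circleChar ((a : ℤ) - b) y := by
    intro y
    push_cast
    rw [← Complex.mul_conj', halfDirichlet, map_sum, Finset.sum_mul_sum]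
    refine Finset.sum_congr rfl fun a _ => Finset.sum_congr rfl fun b _ => ?_
    rw [conj_circleChar, ← circleChar_add, sub_eq_add_neg]
  have : ((∑ j ∈ Finset.range L, ‖halfDirichlet n (x - (j : ℝ) / L)‖ ^ 2 : ℝ) : ℂ) = L * n := by
    rw [Complex.ofReal_sum]
    simp_rw [h]
    rw [Finset.sum_comm]
    simp_rw [Finset.sum_comm (s := Finset.range L), circleChar_sub_arg, ← Finset.mul_sum,
      sum_circleChar_grid hL]
    rw [Finset.sum_congr rfl (g := fun _ => (L : ℂ)), Finset.sum_const, Finset.card_range,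
      nsmul_eq_mul, mul_comm]
    intro a ha
    rw [Finset.sum_eq_single a]
    · simp [circleChar_zero]
    · intro b hb hba
      rw [if_neg, mul_zero]
      rintro ⟨z, hz⟩
      rw [Finset.mem_range] at ha hb
      have h1 : z < 1 := by nlinarith
      have h2 : -1 < z := by nlinarith
      have : z = 0 := by omega
      subst this
      omega
    · exact fun h => absurd ha h
  exact_mod_cast this

lemma sum_circleChar_mul_kernel {N : ℕ} (hN : 0 < N) {s k : ℤ} (hk : s ≤ k) (hk' : k < s + N)
    (x : ℝ) :
    ∑ j ∈ Finset.range (2 * N), circleChar k ((j : ℝ) / (2 * N : ℕ)) *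
      (circleChar s (x - (j : ℝ) / (2 * N : ℕ)) *
        (starRingEnd ℂ) (halfDirichlet N (x - (j : ℝ) / (2 * N : ℕ))) *
        halfDirichlet (2 * N) (x - (j : ℝ) / (2 * N : ℕ))) =
      ((2 * N : ℕ) : ℂ) * N * circleChar k x := by
  set L := 2 * N with hL
  have hL0 : 0 < L := by omega
  have h : ∀ y, circleChar k y * (circleChar s (x - y) *
      (starRingEnd ℂ) (halfDirichlet N (x - y)) * halfDirichlet L (x - y)) =
      ∑ a ∈ Finset.range N, ∑ b ∈ Finset.range L,
        circleChar (s - a + b) x * circleChar (k - s + a - b) y := by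
    intro y
    rw [halfDirichlet, halfDirichlet, map_sum, mul_assoc, Finset.sum_mul_sum, Finset.mul_sum,
      Finset.mul_sum]
    refine Finset.sum_congr rfl fun a _ => ?_
    rw [Finset.mul_sum, Finset.mul_sum]
    refine Finset.sum_congr rfl fun b _ => ?_
    rw [conj_circleChar, ← circleChar_add, ← circleChar_add, circleChar_sub_arg, ← sub_eq_neg_add,
      mul_left_comm, ← circleChar_add]
    congr 2 <;> ring
  simp_rw [h]
  rw [Finset.sum_comm]
  rw [Finset.sum_congr rfl (g := fun _ => (L : ℂ) * circleChar k x), Finset.sum_const,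
    Finset.card_range, nsmul_eq_mul]
  · ring
  intro a ha
  rw [Finset.mem_range] at ha
  rw [Finset.sum_comm]
  simp_rw [← Finset.mul_sum, sum_circleChar_grid hL0]
  have hb0 : (((k - s + a).toNat : ℕ) : ℤ) = k - s + a := Int.toNat_of_nonneg (by omega)
  rw [Finset.sum_eq_single (k - s + a).toNat]
  · rw [hb0, if_pos (by simp), mul_comm]
    congr 2
    ring
  · intro b hb hba
    rw [Finset.mem_range] at hb
    rw [if_neg, mul_zero]
    rintro ⟨z, hz⟩
    have h1 : z < 1 := by
      by_contra! hz1
      nlinarith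
    have h2 : -1 < z := by
      by_contra! hz1
      nlinarith
    have : z = 0 := by omega
    subst this
    omega
  · intro hb
    rw [Finset.mem_range] at hb
    omega

/-- A trigonometric polynomial with `N` consecutive frequencies is controlled by its values on a
uniform grid of `2N` points. -/
lemma norm_sum_circleChar_le_of_grid {N : ℕ} (hN : 0 < N) {s : ℤ} {P : Finset ℤ}
    (hP : ∀ k ∈ P, s ≤ k ∧ k < s + N) {c : ℤ → ℂ} {V : ℝ}
    (hV : ∀ j < 2 * N, ‖∑ k ∈ P, c k * circleChar k ((j : ℝ) / (2 * N : ℕ))‖ ≤ V) (x : ℝ) :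
    ‖∑ k ∈ P, c k * circleChar k x‖ ≤ 3 / 2 * V := by
  have hN0 : (0:ℝ) < N := by exact_mod_cast hN
  set L := 2 * N with hL
  have hL0 : 0 < L := by omega
  have hV0 : 0 ≤ V := (norm_nonneg _).trans (hV 0 hL0)
  have key : ((L : ℕ) : ℂ) * N * ∑ k ∈ P, c k * circleChar k x =
      ∑ j ∈ Finset.range L, (∑ k ∈ P, c k * circleChar k ((j : ℝ) / (L : ℕ))) *
        (circleChar s (x - (j : ℝ) / (L : ℕ)) *
        (starRingEnd ℂ) (halfDirichlet N (x - (j : ℝ) / (L : ℕ))) *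
        halfDirichlet L (x - (j : ℝ) / (L : ℕ))) := by
    simp_rw [Finset.sum_mul]
    rw [Finset.sum_comm, Finset.mul_sum]
    refine Finset.sum_congr rfl fun k hk => ?_
    simp_rw [mul_assoc (c k)]
    rw [← Finset.mul_sum, sum_circleChar_mul_kernel hN (hP k hk).1 (hP k hk).2]
    ring
  have h1 : (L : ℝ) * N * ‖∑ k ∈ P, c k * circleChar k x‖ ≤ V * (3 * N ^ 2) := by
    calc (L : ℝ) * N * ‖∑ k ∈ P, c k * circleChar k x‖
        = ‖((L : ℕ) : ℂ) * N * ∑ k ∈ P, c k * circleChar k x‖ := by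
          rw [norm_mul, norm_mul, Complex.norm_natCast, Complex.norm_natCast]
      _ ≤ ∑ j ∈ Finset.range L, V * ((‖halfDirichlet N (x - (j : ℝ) / (L : ℕ))‖ ^ 2 +
          ‖halfDirichlet L (x - (j : ℝ) / (L : ℕ))‖ ^ 2) / 2) := by
          rw [key]
          refine (norm_sum_le _ _).trans (Finset.sum_le_sum fun j hj => ?_)
          rw [norm_mul, norm_mul, norm_mul, norm_circleChar, one_mul, RCLike.norm_conj]
          refine mul_le_mul (hV j (Finset.mem_range.1 hj)) ?_ (by positivity) hV0
          nlinarith [sq_nonneg (‖halfDirichlet N (x - (j : ℝ) / (L : ℕ))‖ -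
            ‖halfDirichlet L (x - (j : ℝ) / (L : ℕ))‖)]
      _ = V * (3 * N ^ 2) := by
          rw [← Finset.mul_sum, ← Finset.sum_div, Finset.sum_add_distrib,
            sum_normSq_halfDirichlet hL0 (by omega), sum_normSq_halfDirichlet hL0 le_rfl, hL]
          push_cast
          ring
  have h2 : (L : ℝ) * N = 2 * N ^ 2 := by
    rw [hL]
    push_cast
    ring
  rw [h2] at h1
  have h3 : (0:ℝ) < N ^ 2 := by positivity
  nlinarith

lemma card_le_of_forall_abs_le {ρ : ℝ} (hρ : 1 ≤ ρ) {S : Finset (Fin 1 → ℤ)}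
    (hS : ∀ k ∈ S, |(k 0 : ℝ)| ≤ ρ) : (S.card : ℝ) ≤ 3 * ρ := by
  have h1 : S.card ≤ (Finset.Icc (-⌊ρ⌋) ⌊ρ⌋).card := by
    refine Finset.card_le_card_of_injOn (fun k => k 0) (fun k hk => ?_) fun k _ l _ h => ?_
    · have := abs_le.1 (hS k hk)
      refine Finset.mem_coe.2 (Finset.mem_Icc.2 ⟨?_, Int.le_floor.2 this.2⟩)
      rw [neg_le]
      exact Int.le_floor.2 (by push_cast; linarith)
    · funext i
      rw [Subsingleton.elim i 0]
      exact h
  have h0 : 0 ≤ ⌊ρ⌋ := Int.floor_nonneg.2 (by linarith)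
  rw [Int.card_Icc] at h1
  have h2 : (S.card : ℤ) ≤ 2 * ⌊ρ⌋ + 1 := by omega
  have h3 : (S.card : ℝ) ≤ 2 * (⌊ρ⌋ : ℝ) + 1 := by exact_mod_cast h2
  linarith [Int.floor_le ρ]

lemma exists_hasSigning_top {δ : ℝ} (hδ : 0 < δ) (hδ' : δ < 1 / 2) :
    ∃ K : ℝ, 1 ≤ K ∧ ∀ (ρ : ℝ), 1 ≤ ρ → ∀ B : Finset (Fin 1 → ℤ), (∀ k ∈ B, |(k 0 : ℝ)| ≤ ρ) →
      HasSigning (trigSeminorm 1 ∞ le_top B) B (K * ρ ^ δ) (1 / 2 - δ) := by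
  obtain ⟨K, hK, h⟩ := exists_colouring hδ hδ'
  refine ⟨36 * K, by linarith, fun ρ hρ B hB S hS => ?_⟩
  have hSρ : ∀ k ∈ S, |(k 0 : ℝ)| ≤ ρ := fun k hk => hB k (hS hk)
  have hcard := card_le_of_forall_abs_le hρ hSρ
  have h0 : 0 ≤ ⌊ρ⌋ := Int.floor_nonneg.2 (by linarith)
  set N := (2 * ⌊ρ⌋ + 1).toNat with hN
  have hNz : (N : ℤ) = 2 * ⌊ρ⌋ + 1 := Int.toNat_of_nonneg (by omega)
  have hNρ : (N : ℝ) ≤ 3 * ρ := by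
    have : (N : ℝ) = 2 * ⌊ρ⌋ + 1 := by exact_mod_cast hNz
    linarith [Int.floor_le ρ]
  set L := 2 * N with hL
  set y : ℕ → ℝ := fun j => j / L with hy
  obtain ⟨T, hT, hTb⟩ := h (κ := Fin L × Bool) S
    (fun j k => bif j.2 then (circleChar (k 0) (y j.1)).re else (circleChar (k 0) (y j.1)).im)
    (12 * ρ)
    (by
      rintro ⟨j, _ | _⟩ k
      · exact (Complex.abs_im_le_norm _).trans (norm_circleChar _ _).le
      · exact (Complex.abs_re_le_norm _).trans (norm_circleChar _ _).le)
    (by linarith) (by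
      simp only [Fintype.card_prod, Fintype.card_fin, Fintype.card_bool, hL]
      push_cast
      linarith)
  refine ⟨T, hT, ?_⟩
  set n : ℝ := (S.card : ℝ) with hn
  set α := 1 / 2 - δ with hα
  have hMδ : (12 * ρ) ^ δ ≤ 12 * ρ ^ δ := by
    rw [Real.mul_rpow (by norm_num) (by positivity)]
    gcongr
    calc (12:ℝ) ^ δ ≤ 12 ^ (1:ℝ) :=
          Real.rpow_le_rpow_of_exponent_le (by norm_num) (by linarith)
      _ = 12 := Real.rpow_one _
  have hgrid : ∀ j < L, ‖∑ k ∈ S, (if k ∈ T then 1 else -1) * circleChar (k 0) (y j)‖ ≤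
      24 * K * ρ ^ δ * n ^ α := by
    intro j hj
    have hre := hTb (⟨j, hj⟩, true)
    have him := hTb (⟨j, hj⟩, false)
    simp only [cond_true, cond_false] at hre him
    have e1 : (∑ k ∈ S, (if k ∈ T then 1 else -1) * circleChar (k 0) (y j)).re =
        signSum S T fun k => (circleChar (k 0) (y j)).re := by
      rw [Complex.re_sum, signSum]
      exact Finset.sum_congr rfl fun k _ => by split_ifs <;> simp
    have e2 : (∑ k ∈ S, (if k ∈ T then 1 else -1) * circleChar (k 0) (y j)).im =
        signSum S T fun k => (circleChar (k 0) (y j)).im := by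
      rw [Complex.im_sum, signSum]
      exact Finset.sum_congr rfl fun k _ => by split_ifs <;> simp
    rw [← e1] at hre
    rw [← e2] at him
    refine (Complex.norm_le_abs_re_add_abs_im _).trans ?_
    have : K * n ^ α * (12 * ρ) ^ δ ≤ K * n ^ α * (12 * ρ ^ δ) := by gcongr
    linarith
  have hinj : Set.InjOn (fun k : Fin 1 → ℤ => k 0) S := by
    intro k _ l _ h
    funext i
    rw [Subsingleton.elim i 0]
    exact h
  have hsum : ∀ x, ∑ k ∈ S, (if k ∈ T then (1:ℂ) else -1) * circleChar (k 0) x =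
      ∑ k ∈ S.image fun k => k 0, (if (fun _ => k) ∈ T then (1:ℂ) else -1) * circleChar k x := by
    intro x
    rw [Finset.sum_image hinj]
    refine Finset.sum_congr rfl fun k _ => ?_
    have : (fun _ => k 0) = k := by
      funext i
      rw [Subsingleton.elim i 0]
    rw [this]
  simp_rw [hsum] at hgrid
  have hbound : ∀ x, ‖∑ k ∈ B, signVec S T k * expk 1 k x‖ ≤ 36 * K * ρ ^ δ * n ^ α := by
    intro x
    rw [sum_signVec hS]
    simp_rw [expk_one]
    rw [hsum]
    refine (norm_sum_circleChar_le_of_grid (by omega) (s := -⌊ρ⌋) ?_ hgrid (x 0)).trans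
      (le_of_eq (by ring))
    intro k' hk'
    obtain ⟨k, hk, rfl⟩ := Finset.mem_image.1 hk'
    have := abs_le.1 (hSρ k hk)
    have h1 : -k 0 ≤ ⌊ρ⌋ := Int.le_floor.2 (by push_cast; linarith)
    have h2 : k 0 ≤ ⌊ρ⌋ := Int.le_floor.2 this.2
    omega
  exact trigSeminorm_le_of_forall_norm_le le_top (by positivity) hbound

/-! ### Sparse approximation of trigonometric polynomials in the hyperbolic cross -/

lemma abs_le_wt (d : ℕ) (k : Fin d → ℤ) (i : Fin d) : 1 + |(k i : ℝ)| ≤ wt d k := by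
  have h : ∏ j, (if j = i then 1 + |(k i : ℝ)| else 1) = 1 + |(k i : ℝ)| := by simp
  rw [wt, ← h]
  refine Finset.prod_le_prod (fun j _ => by split_ifs <;> positivity) fun j _ => ?_
  split_ifs with hj
  · rw [hj]
  · linarith [abs_nonneg (k j : ℝ)]

lemma HasSigning.exists_sparse_trigSum {d : ℕ} {q : ℝ≥0∞} {hq : 1 ≤ q} {B : Finset (Fin d → ℤ)}
    {A α : ℝ} (h : HasSigning (trigSeminorm d q hq B) B A α) (hA : 1 ≤ A) (hα : 0 ≤ α)
    (hα' : α ≤ 1 / 2) (c : (Fin d → ℤ) → ℂ) {t : ℝ} (ht : 0 < t) :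
    ∃ (b : (Fin d → ℤ) → ℂ) (Λ : Finset (Fin d → ℤ)), (Λ.card : ℝ) ≤ t ∧
      LqNorm d q (fun x => ∑ k ∈ B, c k * expk d k x - ∑ k ∈ Λ, b k * expk d k x) ≤
        ENNReal.ofReal (128 * A * t ^ (α - 1) * ∑ k ∈ B, ‖c k‖) := by
  set c' : (Fin d → ℤ) → ℂ := fun k => if k ∈ B then c k else 0 with hc'
  obtain ⟨b, Λ, hΛ, hcard, hb, hle⟩ := h.exists_sparse
    (fun c _ => trigSeminorm_le_sum d q hq B c) hA hα hα' ht (c := c')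
    (fun k hk => by simp [hc', hk])
  refine ⟨b, Λ, hcard, ?_⟩
  have e1 : ∑ k ∈ B, ‖c' k‖ = ∑ k ∈ B, ‖c k‖ :=
    Finset.sum_congr rfl fun k hk => by simp [hc', hk]
  have e2 : (fun x => ∑ k ∈ B, c k * expk d k x - ∑ k ∈ Λ, b k * expk d k x) =
      fun x => ∑ k ∈ B, (c' - b) k * expk d k x := by
    funext x
    rw [Finset.sum_subset hΛ fun k _ hk => by rw [hb k hk, zero_mul], ← Finset.sum_sub_distrib]
    refine Finset.sum_congr rfl fun k hk => ?_
    simp [hc', hk, sub_mul]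
  rw [e1, trigSeminorm_apply] at hle
  rw [e2]
  exact (ENNReal.le_ofReal_iff_toReal_le (memLp_trigSum d q B _).2.ne
    (by positivity)).2 hle

lemma exists_sparse_trigSum {d : ℕ} {q : ℝ≥0∞} (hq : (2 ≤ q ∧ q ≠ ∞) ∨ (q = ∞ ∧ d = 1))
    {δ : ℝ} (hδ : 0 < δ) (hδ' : δ < 1 / 2) :
    ∃ K : ℝ, 1 ≤ K ∧ ∀ (ρ : ℝ), 1 ≤ ρ → ∀ B : Finset (Fin d → ℤ), (∀ k ∈ B, wt d k ≤ ρ) →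
      ∀ (c : (Fin d → ℤ) → ℂ) (t : ℝ), 0 < t →
      ∃ (b : (Fin d → ℤ) → ℂ) (Λ : Finset (Fin d → ℤ)), (Λ.card : ℝ) ≤ t ∧
        LqNorm d q (fun x => ∑ k ∈ B, c k * expk d k x - ∑ k ∈ Λ, b k * expk d k x) ≤
          ENNReal.ofReal (K * t ^ (-(1 / 2) : ℝ) * (1 + ρ / t) ^ δ * ∑ k ∈ B, ‖c k‖) := by
  rcases hq with ⟨hq, hq'⟩ | ⟨rfl, rfl⟩
  · obtain ⟨A, hA, h⟩ := exists_hasSigning_of_ne_top d (one_le_two.trans hq) hq'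
    refine ⟨128 * A, by linarith, fun ρ hρ B hB c t ht => ?_⟩
    obtain ⟨b, Λ, hΛ, hle⟩ := (h B).exists_sparse_trigSum hA (by norm_num) le_rfl c ht
    refine ⟨b, Λ, hΛ, hle.trans (ENNReal.ofReal_le_ofReal ?_)⟩
    have h1 : 1 ≤ (1 + ρ / t) ^ δ :=
      Real.one_le_rpow (by linarith [show 0 ≤ ρ / t by positivity]) hδ.le
    have h2 : 0 ≤ ∑ k ∈ B, ‖c k‖ := Finset.sum_nonneg fun _ _ => norm_nonneg _
    rw [show (1 / 2 - 1 : ℝ) = -(1 / 2) by norm_num]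
    refine mul_le_mul_of_nonneg_right ?_ h2
    exact le_mul_of_one_le_right (by positivity) h1
  · obtain ⟨K, hK, h⟩ := exists_hasSigning_top hδ hδ'
    refine ⟨128 * K, by linarith, fun ρ hρ B hB c t ht => ?_⟩
    have hρδ : 1 ≤ ρ ^ δ := Real.one_le_rpow hρ hδ.le
    obtain ⟨b, Λ, hΛ, hle⟩ := (h ρ hρ B fun k hk =>
      (by linarith [abs_le_wt 1 k 0, hB k hk])).exists_sparse_trigSum
      (one_le_mul_of_one_le_of_one_le hK hρδ) (by linarith) (by linarith) c ht
    refine ⟨b, Λ, hΛ, hle.trans (ENNReal.ofReal_le_ofReal ?_)⟩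
    have h2 : 0 ≤ ∑ k ∈ B, ‖c k‖ := Finset.sum_nonneg fun _ _ => norm_nonneg _
    have h3 : 128 * (K * ρ ^ δ) * t ^ (1 / 2 - δ - 1) =
        128 * K * t ^ (-(1 / 2) : ℝ) * (ρ / t) ^ δ := by
      rw [Real.div_rpow (by linarith) ht.le,
        show 1 / 2 - δ - 1 = -(1 / 2) - δ by ring, Real.rpow_sub ht]
      ring
    rw [h3]
    gcongr
    linarith

/-! ### Cardinality of hyperbolic crosses -/

lemma one_le_wt (d : ℕ) (k : Fin d → ℤ) : 1 ≤ wt d k := by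
  refine le_trans (le_of_eq (Finset.prod_const_one (s := Finset.univ (α := Fin d))).symm)
    (Finset.prod_le_prod (fun _ _ => zero_le_one) fun i _ => ?_)
  linarith [abs_nonneg (k i : ℝ)]

lemma wt_cons (d : ℕ) (n : ℤ) (k : Fin d → ℤ) :
    wt (d + 1) (Fin.cons n k : Fin (d + 1) → ℤ) = (1 + |(n : ℝ)|) * wt d k := by
  simp [wt, Fin.prod_univ_succ]

open Classical in
/-- The hyperbolic cross `{k : ∏ (1+|k_i|) ≤ ρ}`. -/
def hypCross (d : ℕ) (ρ : ℝ) : Finset (Fin d → ℤ) :=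
  (Fintype.piFinset fun _ => Finset.Icc (-⌊ρ⌋) ⌊ρ⌋).filter fun k => wt d k ≤ ρ

lemma mem_hypCross {d : ℕ} {ρ : ℝ} {k : Fin d → ℤ} : k ∈ hypCross d ρ ↔ wt d k ≤ ρ := by
  rw [hypCross, Finset.mem_filter, Fintype.mem_piFinset, and_iff_right_iff_imp]
  intro h i
  have := abs_le.1 (show |(k i : ℝ)| ≤ ρ by linarith [abs_le_wt d k i])
  refine Finset.mem_Icc.2 ⟨?_, Int.le_floor.2 this.2⟩
  rw [neg_le]
  exact Int.le_floor.2 (by push_cast; linarith)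

lemma card_hypCross_succ (d : ℕ) (ρ : ℝ) : (hypCross (d + 1) ρ).card =
    ∑ n ∈ Finset.Icc (-⌊ρ⌋) ⌊ρ⌋, (hypCross d (ρ / (1 + |(n : ℝ)|))).card := by
  classical
  rw [← Finset.card_sigma]
  symm
  refine Finset.card_bij (fun w _ => (Fin.cons w.1 w.2 : Fin (d + 1) → ℤ)) ?_ ?_ ?_
  · rintro ⟨n, k⟩ h
    have h2 := mem_hypCross.1 (Finset.mem_sigma.1 h).2
    rw [le_div_iff₀ (by positivity), mul_comm] at h2
    rwa [mem_hypCross, wt_cons]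
  · rintro ⟨n, k⟩ _ ⟨n', k'⟩ _ h
    obtain ⟨rfl, rfl⟩ := Fin.cons_inj.1 h
    rfl
  · intro k hk
    rw [mem_hypCross] at hk
    refine ⟨⟨k 0, Fin.tail k⟩, ?_, Fin.cons_self_tail k⟩
    have h0 := abs_le_wt _ k 0
    have := abs_le.1 (show |(k 0 : ℝ)| ≤ ρ by linarith)
    refine Finset.mem_sigma.2 ⟨Finset.mem_Icc.2 ⟨?_, Int.le_floor.2 this.2⟩, ?_⟩
    · rw [neg_le]
      exact Int.le_floor.2 (by push_cast; linarith)
    · rw [mem_hypCross, le_div_iff₀ (by positivity), mul_comm, ← wt_cons, Fin.cons_self_tail]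
      exact hk

lemma sum_one_div_one_add_abs_le {ρ : ℝ} (hρ : 1 ≤ ρ) :
    ∑ n ∈ (Finset.Icc (-⌊ρ⌋) ⌊ρ⌋).filter (fun n : ℤ => 1 + |(n : ℝ)| ≤ ρ), 1 / (1 + |(n : ℝ)|) ≤
      2 * (1 + Real.log ρ) := by
  set N := ⌊ρ⌋₊ with hN
  set f : ℤ → ℝ := fun n => 1 / (1 + |(n : ℝ)|) with hf
  have hf0 : ∀ n, 0 ≤ f n := fun n => by positivity
  set R := Finset.range N
  have hsub : (Finset.Icc (-⌊ρ⌋) ⌊ρ⌋).filter (fun n : ℤ => 1 + |(n : ℝ)| ≤ ρ) ⊆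
      R.image (fun i : ℕ => (i : ℤ)) ∪ R.image (fun i : ℕ => -(i : ℤ)) := by
    intro n hn
    have h1 := (Finset.mem_filter.1 hn).2
    have h2 : n.natAbs ∈ R := by
      rw [Finset.mem_range, Nat.lt_iff_add_one_le, hN, Nat.le_floor_iff (by linarith)]
      push_cast [Nat.cast_natAbs]
      linarith
    rw [Finset.mem_union, Finset.mem_image, Finset.mem_image]
    rcases Int.natAbs_eq n with h | h
    · exact Or.inl ⟨_, h2, h.symm⟩
    · exact Or.inr ⟨_, h2, h.symm⟩
  have hR : ∑ i ∈ R, 1 / (1 + (i : ℝ)) ≤ 1 + Real.log ρ := by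
    have h1 := harmonic_floor_le_one_add_log ρ hρ
    rw [harmonic] at h1
    push_cast at h1
    refine le_trans (le_of_eq (Finset.sum_congr rfl fun i _ => ?_)) h1
    rw [one_div, add_comm]
  calc _ ≤ ∑ n ∈ R.image (fun i : ℕ => (i : ℤ)) ∪ R.image (fun i : ℕ => -(i : ℤ)), f n :=
        Finset.sum_le_sum_of_subset_of_nonneg hsub fun n _ _ => hf0 n
    _ ≤ ∑ n ∈ R.image (fun i : ℕ => (i : ℤ)), f n + ∑ n ∈ R.image (fun i : ℕ => -(i : ℤ)), f n := by
        rw [← Finset.sum_union_inter]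
        exact le_add_of_nonneg_right (Finset.sum_nonneg fun n _ => hf0 n)
    _ = ∑ i ∈ R, 1 / (1 + (i : ℝ)) + ∑ i ∈ R, 1 / (1 + (i : ℝ)) := by
        rw [Finset.sum_image (fun a _ b _ h => by simpa using h),
          Finset.sum_image (fun a _ b _ h => by simpa using h)]
        simp [hf]
    _ ≤ _ := by linarith

lemma exists_card_hypCross_le (d : ℕ) : ∃ C : ℝ, 1 ≤ C ∧ ∀ ρ : ℝ, 1 ≤ ρ →
    ((hypCross (d + 1) ρ).card : ℝ) ≤ C * ρ * (1 + Real.log ρ) ^ d := by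
  induction d with
  | zero =>
    refine ⟨3, by norm_num, fun ρ hρ => ?_⟩
    have := card_le_of_forall_abs_le hρ (S := hypCross 1 ρ) fun k hk => by
      linarith [abs_le_wt 1 k 0, mem_hypCross.1 hk]
    simpa using this
  | succ d ih =>
    obtain ⟨C, hC, h⟩ := ih
    refine ⟨2 * C, by linarith, fun ρ hρ => ?_⟩
    have hl : 0 ≤ Real.log ρ := Real.log_nonneg hρ
    rw [card_hypCross_succ]
    push_cast
    rw [← Finset.sum_filter_of_ne (p := fun n : ℤ => 1 + |(n : ℝ)| ≤ ρ)]
    · calc _ ≤ ∑ n ∈ (Finset.Icc (-⌊ρ⌋) ⌊ρ⌋).filter (fun n : ℤ => 1 + |(n : ℝ)| ≤ ρ),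
            C * ρ * (1 + Real.log ρ) ^ d * (1 / (1 + |(n : ℝ)|)) := by
            refine Finset.sum_le_sum fun n hn => ?_
            have hn' := (Finset.mem_filter.1 hn).2
            have hn1 : 1 ≤ ρ / (1 + |(n : ℝ)|) := (one_le_div (by positivity)).2 hn'
            have h0 : 0 ≤ Real.log (ρ / (1 + |(n : ℝ)|)) := Real.log_nonneg hn1
            refine (h _ hn1).trans ?_
            have h1 : Real.log (ρ / (1 + |(n : ℝ)|)) ≤ Real.log ρ := by
              refine Real.log_le_log (by linarith) (div_le_self (by linarith) ?_)
              linarith [abs_nonneg (n : ℝ)]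
            have h2 : C * (ρ / (1 + |(n : ℝ)|)) * (1 + Real.log (ρ / (1 + |(n : ℝ)|))) ^ d ≤
                C * (ρ / (1 + |(n : ℝ)|)) * (1 + Real.log ρ) ^ d := by gcongr
            refine h2.trans (le_of_eq (by ring))
        _ ≤ C * ρ * (1 + Real.log ρ) ^ d * (2 * (1 + Real.log ρ)) := by
            rw [← Finset.mul_sum]
            exact mul_le_mul_of_nonneg_left (sum_one_div_one_add_abs_le hρ) (by positivity)
        _ = _ := by ring
    · intro n _ hn
      have hn' : (hypCross (d + 1) (ρ / (1 + |(n : ℝ)|))).card ≠ 0 := by exact_mod_cast hn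
      obtain ⟨k, hk⟩ := Finset.card_pos.1 (Nat.pos_of_ne_zero hn')
      exact (one_le_div (by positivity)).1 ((one_le_wt _ k).trans (mem_hypCross.1 hk))

lemma exists_le_card_hypCross (d : ℕ) : ∃ c : ℝ, 0 < c ∧ ∀ ρ : ℝ, 1 ≤ ρ →
    c * ρ * (Real.log ρ) ^ d ≤ (hypCross (d + 1) ρ).card := by
  induction d with
  | zero =>
    refine ⟨1 / 2, by norm_num, fun ρ hρ => ?_⟩
    have h1 : ⌊ρ⌋₊ ≤ (hypCross 1 ρ).card := by
      rw [← Finset.card_range ⌊ρ⌋₊]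
      refine Finset.card_le_card_of_injOn (fun i _ => (i : ℤ)) (fun i hi => ?_) fun i _ j _ h => ?_
      · refine Finset.mem_coe.2 (mem_hypCross.2 ?_)
        rw [Finset.mem_coe, Finset.mem_range, Nat.lt_iff_add_one_le,
          Nat.le_floor_iff (by linarith)] at hi
        push_cast at hi
        simp [wt]
        linarith
      · simpa using congrFun h 0
    have h2 : (⌊ρ⌋₊ : ℝ) ≤ (hypCross 1 ρ).card := by exact_mod_cast h1
    have h3 := Nat.lt_floor_add_one ρ
    have h4 : (1:ℝ) ≤ ⌊ρ⌋₊ := by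
      exact_mod_cast Nat.one_le_floor_iff ρ |>.2 hρ
    simp only [pow_zero, mul_one]
    linarith
  | succ d ih =>
    obtain ⟨c, hc, h⟩ := ih
    refine ⟨c / 2 ^ (d + 1), by positivity, fun ρ hρ => ?_⟩
    have hl : 0 ≤ Real.log ρ := Real.log_nonneg hρ
    have hs1 : 1 ≤ √ρ := Real.one_le_sqrt.2 hρ
    have hlog : Real.log (√ρ) = Real.log ρ / 2 := Real.log_sqrt (by linarith)
    set N := ⌊√ρ⌋₊ with hN
    have hNs : (N : ℝ) ≤ √ρ := Nat.floor_le (by linarith)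
    have hsρ : √ρ * √ρ = ρ := Real.mul_self_sqrt (by linarith)
    have hharm : Real.log ρ / 2 ≤ ∑ i ∈ Finset.range N, 1 / (1 + (i : ℝ)) := by
      have h1 := log_add_one_le_harmonic N
      rw [harmonic] at h1
      push_cast at h1
      rw [← hlog]
      refine (Real.log_le_log (by linarith) (Nat.lt_floor_add_one (√ρ)).le).trans (h1.trans ?_)
      exact le_of_eq (Finset.sum_congr rfl fun i _ => by rw [one_div, add_comm])
    rw [card_hypCross_succ]
    push_cast
    calc c / 2 ^ (d + 1) * ρ * Real.log ρ ^ (d + 1)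
        = c * ρ * (Real.log ρ / 2) ^ d * (Real.log ρ / 2) := by
          rw [pow_succ, pow_succ, div_pow]
          field_simp
      _ ≤ c * ρ * (Real.log ρ / 2) ^ d * ∑ i ∈ Finset.range N, 1 / (1 + (i : ℝ)) := by
          gcongr
      _ = ∑ i ∈ Finset.range N, c * (ρ / (1 + (i : ℝ))) * (Real.log ρ / 2) ^ d := by
          rw [Finset.mul_sum]
          exact Finset.sum_congr rfl fun i _ => by ring
      _ ≤ ∑ i ∈ Finset.range N, ((hypCross (d + 1) (ρ / (1 + |((i : ℤ) : ℝ)|))).card : ℝ) := by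
          refine Finset.sum_le_sum fun i hi => ?_
          have hi' : (i : ℝ) + 1 ≤ N := by exact_mod_cast Finset.mem_range.1 hi
          have hge : √ρ ≤ ρ / (1 + (i : ℝ)) := by
            rw [le_div_iff₀ (by positivity)]
            nlinarith
          have : |((i : ℤ) : ℝ)| = i := by simp
          rw [this]
          refine le_trans ?_ (h _ (hs1.trans hge))
          gcongr
          rw [← hlog]
          exact Real.log_le_log (by linarith) hge
      _ = ∑ n ∈ (Finset.range N).image (fun i : ℕ => (i : ℤ)),
            ((hypCross (d + 1) (ρ / (1 + |(n : ℝ)|))).card : ℝ) := by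
          rw [Finset.sum_image (fun a _ b _ h => by simpa using h)]
      _ ≤ _ := by
          refine Finset.sum_le_sum_of_subset_of_nonneg ?_ fun _ _ _ => by positivity
          intro n hn
          obtain ⟨i, hi, rfl⟩ := Finset.mem_image.1 hn
          have hi' : (i : ℝ) + 1 ≤ N := by exact_mod_cast Finset.mem_range.1 hi
          have h0 : 0 ≤ ⌊ρ⌋ := Int.floor_nonneg.2 (by linarith)
          refine Finset.mem_Icc.2 ⟨by omega, Int.le_floor.2 ?_⟩
          push_cast
          nlinarith

/-! ### Greedy approximation in sequence spaces -/

section Greedy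

variable {ι : Type*} [DecidableEq ι]

lemma exists_greedy_of_le_one {p : ℝ} (hp : 0 < p) (hp1 : p ≤ 1) {F : Finset ι} {a : ι → ℝ}
    (ha : ∀ k, 0 ≤ a k) (hF : ∑ k ∈ F, a k ^ p ≤ 1) {t : ℝ} (ht : 0 < t) :
    ∃ Λ ⊆ F, (Λ.card : ℝ) ≤ t ∧ ∑ k ∈ F \ Λ, a k ≤ t ^ (1 - 1 / p) := by
  set τ := t ^ (-(1 / p)) with hτ
  have hτ0 : 0 < τ := Real.rpow_pos_of_pos ht _
  have hτp : τ ^ p = t⁻¹ := by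
    rw [hτ, ← Real.rpow_mul ht.le, ← Real.rpow_neg_one]
    congr 1
    field_simp
  refine ⟨F.filter fun k => τ < a k, Finset.filter_subset _ _, ?_, ?_⟩
  · have h1 : ((F.filter fun k => τ < a k).card : ℝ) * t⁻¹ ≤ 1 := by
      rw [← nsmul_eq_mul, ← hτp]
      refine (Finset.card_nsmul_le_sum _ (fun k => a k ^ p) _ fun k hk => ?_).trans
        ((Finset.sum_le_sum_of_subset_of_nonneg (Finset.filter_subset _ _)
          fun k _ _ => Real.rpow_nonneg (ha k) _).trans hF)
      exact Real.rpow_le_rpow hτ0.le (Finset.mem_filter.1 hk).2.le hp.le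
    rwa [← div_eq_mul_inv, div_le_one ht] at h1
  · calc ∑ k ∈ F \ F.filter (fun k => τ < a k), a k
        ≤ ∑ k ∈ F \ F.filter (fun k => τ < a k), τ ^ (1 - p) * a k ^ p := by
          refine Finset.sum_le_sum fun k hk => ?_
          have hk' : a k ≤ τ := by
            obtain ⟨h1, h2⟩ := Finset.mem_sdiff.1 hk
            by_contra! h3
            exact h2 (Finset.mem_filter.2 ⟨h1, h3⟩)
          rcases (ha k).eq_or_lt with h0 | h0
          · rw [← h0, Real.zero_rpow hp.ne', mul_zero]
          · calc a k = a k ^ (1 - p) * a k ^ p := by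
                  rw [← Real.rpow_add h0, sub_add_cancel, Real.rpow_one]
              _ ≤ τ ^ (1 - p) * a k ^ p := by
                  have : 0 ≤ 1 - p := by linarith
                  gcongr
      _ ≤ τ ^ (1 - p) * 1 := by
          rw [← Finset.mul_sum]
          gcongr
          exact (Finset.sum_le_sum_of_subset_of_nonneg Finset.sdiff_subset
            fun k _ _ => Real.rpow_nonneg (ha k) _).trans hF
      _ = t ^ (1 - 1 / p) := by
          rw [mul_one, hτ, ← Real.rpow_mul ht.le]
          congr 1
          field_simp
          ring

lemma sum_le_card_rpow_of_one_le {ι : Type*} {p : ℝ} (hp : 1 ≤ p) {F : Finset ι} {a : ι → ℝ}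
    (ha : ∀ k, 0 ≤ a k) (hF : ∑ k ∈ F, a k ^ p ≤ 1) :
    ∑ k ∈ F, a k ≤ (F.card : ℝ) ^ (1 - 1 / p) := by
  have hp0 : 0 < p := by linarith
  have h := Real.rpow_sum_le_const_mul_sum_rpow F a hp
  simp_rw [abs_of_nonneg (ha _)] at h
  have h0 : 0 ≤ ∑ k ∈ F, a k := Finset.sum_nonneg fun k _ => ha k
  have h1 : (∑ k ∈ F, a k) ^ p ≤ (F.card : ℝ) ^ (p - 1) :=
    h.trans (mul_le_of_le_one_right (by positivity) hF)
  calc ∑ k ∈ F, a k = ((∑ k ∈ F, a k) ^ p) ^ (1 / p) := by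
        rw [← Real.rpow_mul h0, mul_one_div_cancel hp0.ne', Real.rpow_one]
    _ ≤ ((F.card : ℝ) ^ (p - 1)) ^ (1 / p) := by gcongr
    _ = _ := by
        rw [← Real.rpow_mul (by positivity)]
        congr 1
        field_simp

/-- The non-negative sequence `a` lies in the unit ball of `ℓ_θ`. -/
def InUnitBall {ι : Type*} (θ : ℝ≥0∞) (a : ι → ℝ) : Prop :=
  (∀ k, 0 ≤ a k) ∧ (θ = ∞ → ∀ k, a k ≤ 1) ∧
    (θ ≠ ∞ → ∀ F : Finset ι, ∑ k ∈ F, a k ^ θ.toReal ≤ 1)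

lemma InUnitBall.exists_greedy {θ : ℝ≥0∞} (hθ : 0 < θ) {a : ι → ℝ} (ha : InUnitBall θ a)
    (F : Finset ι) {t : ℝ} (ht : 0 < t) :
    ∃ Λ ⊆ F, (Λ.card : ℝ) ≤ t ∧ ∑ k ∈ F \ Λ, a k ≤
      t ^ (1 - 1 / θ.toReal) * (1 + F.card / t) ^ max (1 - 1 / θ.toReal) 0 := by
  obtain ⟨h0, h1, h2⟩ := ha
  have hbig : ∀ s : ℝ, s ≤ 1 → (F.card : ℝ) ^ (1 - s) ≤ t ^ (1 - s) * (1 + F.card / t) ^ (1 - s) := by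
    intro s hs
    rw [← Real.mul_rpow ht.le (by positivity)]
    have : (F.card : ℝ) ≤ t * (1 + F.card / t) := by
      rw [mul_add, mul_div_cancel₀ _ ht.ne']
      linarith
    have : 0 ≤ 1 - s := by linarith
    gcongr
  by_cases hθ' : θ = ∞
  · refine ⟨∅, Finset.empty_subset _, by simpa using ht.le, ?_⟩
    have := hbig 0 zero_le_one
    rw [hθ', Finset.sdiff_empty]
    simp only [ENNReal.toReal_top, _root_.div_zero, sub_zero, Real.rpow_one] at this ⊢
    rw [max_eq_left zero_le_one, Real.rpow_one]
    refine le_trans ?_ this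
    calc ∑ k ∈ F, a k ≤ ∑ _k ∈ F, 1 := Finset.sum_le_sum fun k _ => h1 hθ' k
      _ = F.card := by simp
  · have hp : 0 < θ.toReal := ENNReal.toReal_pos hθ.ne' hθ'
    rcases le_total θ.toReal 1 with hp1 | hp1
    · obtain ⟨Λ, hΛ, hc, hs⟩ := exists_greedy_of_le_one hp hp1 h0 (h2 hθ' F) ht
      refine ⟨Λ, hΛ, hc, hs.trans ?_⟩
      have : 1 - 1 / θ.toReal ≤ 0 := by
        rw [sub_nonpos]
        exact (one_le_div hp).2 hp1
      rw [max_eq_right this, Real.rpow_zero, mul_one]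
    · refine ⟨∅, Finset.empty_subset _, by simpa using ht.le, ?_⟩
      have hs : 1 / θ.toReal ≤ 1 := (div_le_one hp).2 hp1
      rw [Finset.sdiff_empty, max_eq_left (by linarith)]
      exact (sum_le_card_rpow_of_one_le hp1 h0 (h2 hθ' F)).trans (hbig _ hs)

end Greedy

lemma wt_pos (d : ℕ) (k : Fin d → ℤ) : 0 < wt d k := zero_lt_one.trans_le (one_le_wt d k)

lemma inUnitBall_of_wienerNorm_le {d : ℕ} {r : ℝ} {θ : ℝ≥0∞} (hθ : 0 < θ)
    {f : (Fin d → ℝ) → ℂ} (hf : wienerNorm d r θ f ≤ 1) :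
    InUnitBall θ fun k => wt d k ^ r * ‖fCoeff d f k‖ := by
  have hw : ∀ k, 0 ≤ wt d k ^ r := fun k => Real.rpow_nonneg (wt_pos d k).le _
  have he : ∀ k, ENNReal.ofReal (wt d k ^ r) * (‖fCoeff d f k‖₊ : ℝ≥0∞) =
      ENNReal.ofReal (wt d k ^ r * ‖fCoeff d f k‖) := by
    intro k
    rw [ENNReal.ofReal_mul (hw k), ofReal_norm]
    rfl
  refine ⟨fun k => mul_nonneg (hw k) (norm_nonneg _), fun h k => ?_, fun h F => ?_⟩
  · rw [wienerNorm, if_pos h] at hf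
    have := (le_iSup (fun k => ENNReal.ofReal (wt d k ^ r) * (‖fCoeff d f k‖₊ : ℝ≥0∞)) k).trans hf
    rw [he] at this
    exact ENNReal.ofReal_le_one.1 this
  · have hp : 0 < θ.toReal := ENNReal.toReal_pos hθ.ne' h
    rw [wienerNorm, if_neg h] at hf
    rw [one_div, ENNReal.rpow_inv_le_iff hp, ENNReal.one_rpow] at hf
    have h2 := (ENNReal.sum_le_tsum F).trans hf
    simp_rw [he] at h2
    rw [Finset.sum_congr rfl fun k _ =>
      ENNReal.ofReal_rpow_of_nonneg (mul_nonneg (hw k) (norm_nonneg _)) hp.le,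
      ← ENNReal.ofReal_sum_of_nonneg fun k _ => Real.rpow_nonneg (mul_nonneg (hw k) (norm_nonneg _)) _]
      at h2
    exact ENNReal.ofReal_le_one.1 h2

lemma exists_greedy_fCoeff {d : ℕ} {r : ℝ} {θ : ℝ≥0∞} (hθ : 0 < θ) (hr : 0 ≤ r)
    {f : (Fin d → ℝ) → ℂ} (hf : wienerNorm d r θ f ≤ 1) {F : Finset (Fin d → ℤ)} {ρ : ℝ}
    (hρ : 0 < ρ) (hF : ∀ k ∈ F, ρ ≤ wt d k) {t : ℝ} (ht : 0 < t) :
    ∃ Λ ⊆ F, (Λ.card : ℝ) ≤ t ∧ ∑ k ∈ F \ Λ, ‖fCoeff d f k‖ ≤ ρ ^ (-r) *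
      (t ^ (1 - 1 / θ.toReal) * (1 + F.card / t) ^ max (1 - 1 / θ.toReal) 0) := by
  classical
  obtain ⟨Λ, hΛ, hc, hs⟩ := (inUnitBall_of_wienerNorm_le hθ hf).exists_greedy hθ F ht
  refine ⟨Λ, hΛ, hc, le_trans ?_ (mul_le_mul_of_nonneg_left hs (by positivity))⟩
  rw [Finset.mul_sum]
  refine Finset.sum_le_sum fun k hk => ?_
  have h1 : ρ ^ r ≤ wt d k ^ r := by
    have := hF k (Finset.sdiff_subset hk)
    gcongr
  rw [Real.rpow_neg hρ.le, ← div_eq_inv_mul, le_div_iff₀ (by positivity), mul_comm]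
  gcongr

/-! ### Upper bound -/

lemma trigSum_mem_trigPoly (d : ℕ) (Λ : Finset (Fin d → ℤ)) (a : (Fin d → ℤ) → ℂ) :
    (fun x => ∑ k ∈ Λ, a k * expk d k x) ∈ trigPoly d Λ.card :=
  ⟨Λ, a, le_rfl, rfl⟩

lemma trigPoly_mono {d m n : ℕ} (h : m ≤ n) : trigPoly d m ⊆ trigPoly d n := by
  rintro _ ⟨Λ, a, hc, rfl⟩
  exact ⟨Λ, a, hc.trans h, rfl⟩

lemma trigSum_add_trigSum {d : ℕ} (Λ Λ' : Finset (Fin d → ℤ)) (a b : (Fin d → ℤ) → ℂ) :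
    (fun x => ∑ k ∈ Λ, a k * expk d k x) + (fun x => ∑ k ∈ Λ', b k * expk d k x) =
      fun x => ∑ k ∈ Λ ∪ Λ', ((if k ∈ Λ then a k else 0) + if k ∈ Λ' then b k else 0) *
        expk d k x := by
  funext x
  simp only [Pi.add_apply, add_mul, Finset.sum_add_distrib, ite_mul, zero_mul]
  rw [Finset.sum_ite_mem, Finset.sum_ite_mem, Finset.inter_eq_right.2 Finset.subset_union_left,
    Finset.inter_eq_right.2 Finset.subset_union_right]

lemma add_mem_trigPoly {d m n : ℕ} {s u : (Fin d → ℝ) → ℂ} (hs : s ∈ trigPoly d m)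
    (hu : u ∈ trigPoly d n) : s + u ∈ trigPoly d (m + n) := by
  obtain ⟨Λ, a, hc, rfl⟩ := hs
  obtain ⟨Λ', b, hc', rfl⟩ := hu
  exact ⟨_, _, (Finset.card_union_le _ _).trans (add_le_add hc hc'), trigSum_add_trigSum _ _ _ _⟩

lemma continuous_of_mem_trigPoly {d m : ℕ} {s : (Fin d → ℝ) → ℂ} (hs : s ∈ trigPoly d m) :
    Continuous s := by
  obtain ⟨Λ, a, -, rfl⟩ := hs
  exact continuous_trigSum d Λ a

lemma exists_sparse_block {d : ℕ} {r : ℝ} {θ : ℝ≥0∞} (hθ : 0 < θ) (hr : 0 ≤ r)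
    {q : ℝ≥0∞} {K δ : ℝ} (hK : 0 ≤ K)
    (hsparse : ∀ ρ : ℝ, 1 ≤ ρ → ∀ B : Finset (Fin d → ℤ), (∀ k ∈ B, wt d k ≤ ρ) →
      ∀ (c : (Fin d → ℤ) → ℂ) (t : ℝ), 0 < t → ∃ (b : (Fin d → ℤ) → ℂ) (Λ : Finset (Fin d → ℤ)),
        (Λ.card : ℝ) ≤ t ∧
        LqNorm d q (fun x => ∑ k ∈ B, c k * expk d k x - ∑ k ∈ Λ, b k * expk d k x) ≤
          ENNReal.ofReal (K * t ^ (-(1 / 2) : ℝ) * (1 + ρ / t) ^ δ * ∑ k ∈ B, ‖c k‖))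
    {f : (Fin d → ℝ) → ℂ} (hf : wienerNorm d r θ f ≤ 1) {F : Finset (Fin d → ℤ)} {ρ : ℝ}
    (hρ : 1 ≤ ρ) (hF : ∀ k ∈ F, ρ ≤ wt d k) (hF' : ∀ k ∈ F, wt d k ≤ 2 * ρ) {t : ℝ} (ht : 0 < t) :
    ∃ (n : ℕ) (s : (Fin d → ℝ) → ℂ), s ∈ trigPoly d n ∧ (n : ℝ) ≤ 2 * t ∧
      LqNorm d q ((fun x => ∑ k ∈ F, fCoeff d f k * expk d k x) - s) ≤
        ENNReal.ofReal (K * t ^ (-(1 / 2) : ℝ) * (1 + 2 * ρ / t) ^ δ * (ρ ^ (-r) *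
          (t ^ (1 - 1 / θ.toReal) * (1 + F.card / t) ^ max (1 - 1 / θ.toReal) 0))) := by
  classical
  obtain ⟨Λ, hΛ, hc, hs⟩ := exists_greedy_fCoeff hθ hr hf (zero_lt_one.trans_le hρ) hF ht
  obtain ⟨b, Λ', hc', hb⟩ := hsparse (2 * ρ) (by linarith) (F \ Λ)
    (fun k hk => hF' k (Finset.sdiff_subset hk)) (fCoeff d f) t ht
  refine ⟨_, _, add_mem_trigPoly (trigSum_mem_trigPoly d Λ (fCoeff d f))
    (trigSum_mem_trigPoly d Λ' b), by push_cast; linarith, ?_⟩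
  refine le_trans (le_of_eq ?_) (hb.trans (ENNReal.ofReal_le_ofReal ?_))
  · congr 1
    funext x
    simp only [Pi.sub_apply, Pi.add_apply]
    rw [← Finset.sum_sdiff hΛ]
    ring
  · gcongr

lemma LqNorm_add_le {d : ℕ} {q : ℝ≥0∞} (hq : 1 ≤ q) {f g : (Fin d → ℝ) → ℂ}
    (hf : AEStronglyMeasurable f (cubeMeasure d)) (hg : AEStronglyMeasurable g (cubeMeasure d)) :
    LqNorm d q (f + g) ≤ LqNorm d q f + LqNorm d q g :=
  eLpNorm_add_le hf hg hq

lemma exists_trigPoly_of_blocks {d : ℕ} {q : ℝ≥0∞} (hq : 1 ≤ q) {F : ℕ → Finset (Fin d → ℤ)}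
    (hF : ∀ j, F j ⊆ F (j + 1)) (c : (Fin d → ℤ) → ℂ) {T E : ℕ → ℝ} (hE : ∀ j, 0 ≤ E j)
    (h : ∀ j, ∃ (n : ℕ) (s : (Fin d → ℝ) → ℂ), s ∈ trigPoly d n ∧ (n : ℝ) ≤ T j ∧
      LqNorm d q ((fun x => ∑ k ∈ F (j + 1) \ F j, c k * expk d k x) - s) ≤ ENNReal.ofReal (E j))
    (J : ℕ) :
    ∃ (n : ℕ) (s : (Fin d → ℝ) → ℂ), s ∈ trigPoly d n ∧
      (n : ℝ) ≤ (F 0).card + ∑ j ∈ Finset.range J, T j ∧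
      LqNorm d q ((fun x => ∑ k ∈ F J, c k * expk d k x) - s) ≤
        ENNReal.ofReal (∑ j ∈ Finset.range J, E j) := by
  induction J with
  | zero =>
    refine ⟨_, _, trigSum_mem_trigPoly d (F 0) c, by simp, ?_⟩
    simp [LqNorm]
  | succ J ih =>
    obtain ⟨n, s, hs, hn, hb⟩ := ih
    obtain ⟨n', s', hs', hn', hb'⟩ := h J
    refine ⟨_, _, add_mem_trigPoly hs hs', ?_, ?_⟩
    · rw [Finset.sum_range_succ]
      push_cast
      linarith
    · rw [Finset.sum_range_succ, ENNReal.ofReal_add (Finset.sum_nonneg fun j _ => hE j) (hE J)]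
      have e : (fun x => ∑ k ∈ F (J + 1), c k * expk d k x) - (s + s') =
          ((fun x => ∑ k ∈ F J, c k * expk d k x) - s) +
            ((fun x => ∑ k ∈ F (J + 1) \ F J, c k * expk d k x) - s') := by
        funext x
        simp only [Pi.sub_apply, Pi.add_apply]
        rw [← Finset.sum_sdiff (hF J)]
        ring
      rw [e]
      exact (LqNorm_add_le hq
        ((continuous_trigSum d _ c).sub (continuous_of_mem_trigPoly hs)).aestronglyMeasurable
        ((continuous_trigSum d _ c).sub (continuous_of_mem_trigPoly hs')).aestronglyMeasurable).trans
        (add_le_add hb hb')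

lemma sigmaF_le_of_blocks {d m : ℕ} {q : ℝ≥0∞} (hq : 1 ≤ q) {f : (Fin d → ℝ) → ℂ}
    (hf : IntegrableOn f (cube d)) (hs : Summable fun k => ‖fCoeff d f k‖)
    {F : ℕ → Finset (Fin d → ℤ)} (hF : ∀ j, F j ⊆ F (j + 1)) (hF' : ∀ k, ∃ j, k ∈ F j)
    {T E : ℕ → ℝ} (hE : ∀ j, 0 ≤ E j)
    (h : ∀ j, ∃ (n : ℕ) (s : (Fin d → ℝ) → ℂ), s ∈ trigPoly d n ∧ (n : ℝ) ≤ T j ∧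
      LqNorm d q ((fun x => ∑ k ∈ F (j + 1) \ F j, fCoeff d f k * expk d k x) - s) ≤
        ENNReal.ofReal (E j))
    (hT : ∀ J, (F 0).card + ∑ j ∈ Finset.range J, T j ≤ m) {S : ℝ} (hS0 : 0 < S)
    (hS : ∀ J, ∑ j ∈ Finset.range J, E j ≤ S) :
    sigmaF d m (LqNorm d q) f ≤ ENNReal.ofReal (2 * S) := by
  classical
  obtain ⟨S₀, hS₀⟩ := exists_LqNorm_sub_partialSum_le d q hf hs hS0
  have hmono : Monotone F := monotone_nat_of_le_succ hF
  obtain ⟨J, hJ⟩ : ∃ J, S₀ ⊆ F J := by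
    choose j hj using hF'
    exact ⟨S₀.sup j, fun k hk => hmono (Finset.le_sup hk) (hj k)⟩
  obtain ⟨n, s, hs, hn, hb⟩ := exists_trigPoly_of_blocks hq hF (fCoeff d f) hE h J
  have hnm : n ≤ m := by exact_mod_cast hn.trans (hT J)
  refine (iInf₂_le s (trigPoly_mono hnm hs)).trans ?_
  have e : f - s = (fun x => f x - ∑ k ∈ F J, fCoeff d f k * expk d k x) +
      ((fun x => ∑ k ∈ F J, fCoeff d f k * expk d k x) - s) := by
    funext x
    simp only [Pi.sub_apply, Pi.add_apply]
    ring
  rw [e, two_mul, ENNReal.ofReal_add hS0.le hS0.le]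
  refine (LqNorm_add_le hq
    (hf.aestronglyMeasurable.sub (continuous_trigSum d _ _).aestronglyMeasurable)
    ((continuous_trigSum d _ _).sub (continuous_of_mem_trigPoly hs)).aestronglyMeasurable).trans
    (add_le_add (hS₀ _ hJ) (hb.trans (ENNReal.ofReal_le_ofReal (hS J))))

lemma block_error_le {m R y L t N s r β ε δ a : ℝ} (hm : 0 < m) (hR : 0 < R) (hRm : R ≤ m)
    (hy : 1 ≤ y) (hL : 1 ≤ L) (ha : 0 < a) (ha1 : a ≤ 1) (ht : t = a * m * y ^ (-ε))
    (hN0 : 0 ≤ N) (hN : N ≤ m * y * L) (hβ : 0 ≤ β) (hβ1 : β ≤ 1) (hδ : 0 ≤ δ)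
    (hε : 0 ≤ ε) (hε1 : ε ≤ 1) (hεg : ε * (s + 2) ≤ (r - β) / 4) (hδg : δ ≤ (r - β) / 8) :
    t ^ (-(1 / 2) : ℝ) * (1 + 2 * (R * y) / t) ^ δ *
        ((R * y) ^ (-r) * (t ^ (1 - s) * (1 + N / t) ^ β)) ≤
      a ^ (1 / 2 - s) * (3 / a) ^ δ * (2 / a) ^ β *
        (m ^ (1 / 2 - s) * R ^ (-r)) * (y ^ (-((r - β) / 2)) * L) := by
  have hy0 : 0 < y := by linarith
  have hyε : 0 < y ^ (-ε) := Real.rpow_pos_of_pos hy0 _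
  have ht0 : 0 < t := by rw [ht]; positivity
  have hyy : 1 ≤ y ^ (1 + ε) := Real.one_le_rpow hy (by linarith)
  have hinv : 1 / t = y ^ ε / (a * m) := by
    rw [ht, Real.rpow_neg hy0.le]
    field_simp
  have hya : y ^ (1 + ε) = y * y ^ ε := by rw [Real.rpow_add hy0, Real.rpow_one]
  have hyε' : 0 < y ^ ε := Real.rpow_pos_of_pos hy0 _
  have h1 : 1 + 2 * (R * y) / t ≤ 3 / a * y ^ (1 + ε) := by
    have e1 : 2 * (R * y) / t = 2 / a * y ^ (1 + ε) * (R / m) := by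
      rw [div_eq_mul_one_div, hinv, hya]
      field_simp
    have e2 : R / m ≤ 1 := (div_le_one hm).2 hRm
    have e3 : 2 / a * y ^ (1 + ε) * (R / m) ≤ 2 / a * y ^ (1 + ε) :=
      mul_le_of_le_one_right (by positivity) e2
    have e4 : 1 ≤ 1 / a * y ^ (1 + ε) :=
      one_le_mul_of_one_le_of_one_le ((one_le_div ha).2 ha1) hyy
    rw [e1]
    calc _ ≤ 1 / a * y ^ (1 + ε) + 2 / a * y ^ (1 + ε) := add_le_add e4 e3
      _ = _ := by ring
  have h2 : 1 + N / t ≤ 2 / a * (y ^ (1 + ε) * L) := by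
    have e1 : N / t ≤ 1 / a * (y ^ (1 + ε) * L) := by
      rw [div_eq_mul_one_div, hinv, hya]
      calc N * (y ^ ε / (a * m)) ≤ (m * y * L) * (y ^ ε / (a * m)) := by gcongr
        _ = _ := by field_simp
    have e4 : 1 ≤ 1 / a * (y ^ (1 + ε) * L) :=
      one_le_mul_of_one_le_of_one_le ((one_le_div ha).2 ha1)
        (one_le_mul_of_one_le_of_one_le hyy hL)
    calc _ ≤ 1 / a * (y ^ (1 + ε) * L) + 1 / a * (y ^ (1 + ε) * L) := add_le_add e4 e1
      _ = _ := by ring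
  have h3 : (1 + 2 * (R * y) / t) ^ δ ≤ (3 / a) ^ δ * y ^ ((1 + ε) * δ) := by
    rw [Real.rpow_mul hy0.le, ← Real.mul_rpow (by positivity) (by positivity)]
    gcongr
  have h4 : (1 + N / t) ^ β ≤ (2 / a) ^ β * (y ^ ((1 + ε) * β) * L) := by
    calc (1 + N / t) ^ β ≤ (2 / a * (y ^ (1 + ε) * L)) ^ β := by gcongr
      _ = (2 / a) ^ β * (y ^ ((1 + ε) * β) * L ^ β) := by
        rw [Real.mul_rpow (by positivity) (by positivity),
          Real.mul_rpow (by positivity) (by positivity), Real.rpow_mul hy0.le]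
      _ ≤ (2 / a) ^ β * (y ^ ((1 + ε) * β) * L) := by
        gcongr
        exact Real.rpow_le_self_of_one_le hL hβ1
  have h5 : t ^ (-(1 / 2) : ℝ) * t ^ (1 - s) =
      a ^ (1 / 2 - s) * m ^ (1 / 2 - s) * y ^ (-ε * (1 / 2 - s)) := by
    rw [← Real.rpow_add ht0, ht, Real.rpow_mul hy0.le, ← Real.mul_rpow ha.le hm.le,
      ← Real.mul_rpow (by positivity) hyε.le]
    congr 1
    ring
  calc _ = t ^ (-(1 / 2) : ℝ) * t ^ (1 - s) * (R ^ (-r) * y ^ (-r)) *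
        ((1 + 2 * (R * y) / t) ^ δ * (1 + N / t) ^ β) := by
        rw [Real.mul_rpow hR.le hy0.le]
        ring
    _ ≤ a ^ (1 / 2 - s) * m ^ (1 / 2 - s) * y ^ (-ε * (1 / 2 - s)) * (R ^ (-r) * y ^ (-r)) *
        ((3 / a) ^ δ * y ^ ((1 + ε) * δ) * ((2 / a) ^ β * (y ^ ((1 + ε) * β) * L))) := by
        rw [h5]
        gcongr
    _ = a ^ (1 / 2 - s) * (3 / a) ^ δ * (2 / a) ^ β * (m ^ (1 / 2 - s) * R ^ (-r)) *
        (y ^ (-ε * (1 / 2 - s) + -r + (1 + ε) * δ + (1 + ε) * β) * L) := by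
        rw [Real.rpow_add hy0, Real.rpow_add hy0, Real.rpow_add hy0]
        ring
    _ ≤ _ := by
        gcongr
        nlinarith [mul_le_mul_of_nonneg_right hε1 hδ, mul_le_mul_of_nonneg_left hβ1 hε]

lemma two_pow_rpow_eq (h : ℝ) (j : ℕ) : ((2:ℝ) ^ j) ^ h = ((2:ℝ) ^ h) ^ j := by
  rw [← Real.rpow_natCast, ← Real.rpow_natCast, ← Real.rpow_mul zero_le_two,
    ← Real.rpow_mul zero_le_two, mul_comm]

lemma summable_two_pow_rpow_neg_mul {h : ℝ} (hh : 0 < h) (D : ℕ) :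
    Summable fun j : ℕ => ((2:ℝ) ^ j) ^ (-h) * ((j:ℝ) + 3) ^ D := by
  have hx0 : (0:ℝ) < 2 ^ (-h) := by positivity
  have hx1 : (2:ℝ) ^ (-h) < 1 := Real.rpow_lt_one_of_one_lt_of_neg one_lt_two (by linarith)
  generalize hx : (2:ℝ) ^ (-h) = x at hx0 hx1
  have h0 : Summable fun n : ℕ => (n:ℝ) ^ D * x ^ n :=
    summable_pow_mul_geometric_of_norm_lt_one D (by rwa [Real.norm_of_nonneg hx0.le])
  have h1 : Summable fun j : ℕ => (x ^ 3)⁻¹ * (((j + 3 : ℕ) : ℝ) ^ D * x ^ (j + 3)) :=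
    ((summable_nat_add_iff 3).2 h0).mul_left _
  refine h1.congr fun j => ?_
  rw [two_pow_rpow_eq, hx, pow_add, Nat.cast_add, Nat.cast_ofNat]
  field_simp

lemma card_hypCross_two_pow_le {D : ℕ} {C R M : ℝ}
    (hC : ∀ ρ : ℝ, 1 ≤ ρ → ((hypCross (D + 1) ρ).card : ℝ) ≤ C * ρ * (1 + Real.log ρ) ^ D)
    (hC0 : 0 ≤ C) (hR : 1 ≤ R) (hM : C * R * (1 + Real.log R) ^ D ≤ M) (j : ℕ) :
    ((hypCross (D + 1) (R * 2 ^ (j + 1))).card : ℝ) ≤ 2 * M * 2 ^ j * ((j:ℝ) + 3) ^ D := by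
  have h2 : (1:ℝ) ≤ 2 ^ (j + 1) := one_le_pow₀ one_le_two
  have hlR : 0 ≤ Real.log R := Real.log_nonneg hR
  have hlog : 1 + Real.log (R * 2 ^ (j + 1)) ≤ (1 + Real.log R) * ((j:ℝ) + 3) := by
    rw [Real.log_mul (by positivity) (by positivity), Real.log_pow]
    have := Real.log_two_lt_d9
    have hj : (0:ℝ) ≤ j := j.cast_nonneg
    push_cast
    nlinarith [mul_nonneg hlR hj]
  have hl0 : 0 ≤ Real.log (R * 2 ^ (j + 1)) :=
    Real.log_nonneg (one_le_mul_of_one_le_of_one_le hR h2)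
  calc _ ≤ C * (R * 2 ^ (j + 1)) * (1 + Real.log (R * 2 ^ (j + 1))) ^ D :=
        hC _ (one_le_mul_of_one_le_of_one_le hR h2)
    _ ≤ C * (R * 2 ^ (j + 1)) * ((1 + Real.log R) * ((j:ℝ) + 3)) ^ D := by gcongr
    _ = 2 * (C * R * (1 + Real.log R) ^ D) * 2 ^ j * ((j:ℝ) + 3) ^ D := by
      rw [mul_pow]
      ring
    _ ≤ _ := by gcongr

lemma hypCross_mono (d : ℕ) {ρ ρ' : ℝ} (h : ρ ≤ ρ') : hypCross d ρ ⊆ hypCross d ρ' :=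
  fun _ hk => mem_hypCross.2 ((mem_hypCross.1 hk).trans h)

lemma hypCross_two_pow_subset_succ (d : ℕ) {R : ℝ} (hR : 0 ≤ R) (j : ℕ) :
    hypCross d (R * 2 ^ j) ⊆ hypCross d (R * 2 ^ (j + 1)) :=
  hypCross_mono d (by gcongr <;> simp)

lemma exists_subset_hypCross_two_pow (d : ℕ) {R : ℝ} (hR : 0 < R) (u : Finset (Fin d → ℤ)) :
    ∃ j : ℕ, u ⊆ hypCross d (R * 2 ^ j) := by
  obtain ⟨j, hj⟩ := pow_unbounded_of_one_lt ((∑ k ∈ u, wt d k) / R) one_lt_two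
  refine ⟨j, fun k hk => mem_hypCross.2 ?_⟩
  calc wt d k ≤ ∑ k ∈ u, wt d k := Finset.single_le_sum (fun k _ => (wt_pos d k).le) hk
    _ ≤ R * 2 ^ j := by
      rw [div_lt_iff₀ hR] at hj
      linarith

lemma wt_of_mem_hypCross_sdiff {d : ℕ} {R : ℝ} {j : ℕ} {k : Fin d → ℤ}
    (hk : k ∈ hypCross d (R * 2 ^ (j + 1)) \ hypCross d (R * 2 ^ j)) :
    R * 2 ^ j ≤ wt d k ∧ wt d k ≤ 2 * (R * 2 ^ j) := by
  rw [Finset.mem_sdiff, mem_hypCross, mem_hypCross, not_le] at hk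
  refine ⟨hk.2.le, hk.1.trans_eq (by ring)⟩

lemma summable_norm_fCoeff {D : ℕ} {r : ℝ} {θ : ℝ≥0∞} (hθ : 0 < θ)
    (hr : max (1 - 1 / θ.toReal) 0 < r) {f : (Fin (D + 1) → ℝ) → ℂ}
    (hf : wienerNorm (D + 1) r θ f ≤ 1) : Summable fun k => ‖fCoeff (D + 1) f k‖ := by
  classical
  obtain ⟨C, hC1, hC⟩ := exists_card_hypCross_le D
  set β := max (1 - 1 / θ.toReal) 0 with hβ
  have hβ0 : 0 ≤ β := le_max_right _ _
  have hβ1 : β ≤ 1 := max_le (by have : 0 ≤ 1 / θ.toReal := by positivity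
                                 linarith) zero_le_one
  have hsum := (summable_two_pow_rpow_neg_mul (sub_pos.2 hr) D).mul_left
    ((1 / 2) ^ (1 - 1 / θ.toReal) * (5 * C) ^ β)
  set G := fun j : ℕ => (1 / 2 : ℝ) ^ (1 - 1 / θ.toReal) * (5 * C) ^ β *
    (((2:ℝ) ^ j) ^ (-(r - β)) * ((j:ℝ) + 3) ^ D) with hG
  have hG0 : ∀ j, 0 ≤ G j := fun j => by positivity
  set F := fun j : ℕ => hypCross (D + 1) ((1:ℝ) * 2 ^ j) with hF
  have hblock : ∀ j, ∑ k ∈ F (j + 1) \ F j, ‖fCoeff (D + 1) f k‖ ≤ G j := by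
    intro j
    have hy : (1:ℝ) ≤ 2 ^ j := one_le_pow₀ one_le_two
    have hL : (1:ℝ) ≤ ((j:ℝ) + 3) ^ D := one_le_pow₀ (by linarith [j.cast_nonneg (α := ℝ)])
    obtain ⟨Λ, hΛ, hc, hs⟩ := exists_greedy_fCoeff hθ (hβ0.trans hr.le) hf
      (F := F (j + 1) \ F j) (ρ := 1 * 2 ^ j) (by positivity)
      (fun k hk => (wt_of_mem_hypCross_sdiff hk).1) (one_half_pos (α := ℝ))
    have hΛ0 : Λ = ∅ := by
      rw [← Finset.card_eq_zero]
      have : (Λ.card : ℝ) < 1 := by linarith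
      have : Λ.card < 1 := by exact_mod_cast this
      omega
    rw [hΛ0, Finset.sdiff_empty] at hs
    refine hs.trans ?_
    have hN : ((F (j + 1) \ F j).card : ℝ) ≤ 2 * C * 2 ^ j * ((j:ℝ) + 3) ^ D :=
      (Nat.cast_le.2 (Finset.card_le_card Finset.sdiff_subset)).trans
        (card_hypCross_two_pow_le hC (by linarith) le_rfl (M := C) (by simp) j)
    have h1 : 1 + ((F (j + 1) \ F j).card : ℝ) / (1 / 2) ≤ 5 * C * (2 ^ j * ((j:ℝ) + 3) ^ D) := by
      have : 1 ≤ C * (2 ^ j * ((j:ℝ) + 3) ^ D) :=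
        one_le_mul_of_one_le_of_one_le hC1 (one_le_mul_of_one_le_of_one_le hy hL)
      linarith
    calc _ ≤ ((1:ℝ) * 2 ^ j) ^ (-r) * ((1 / 2) ^ (1 - 1 / θ.toReal) *
          (5 * C * (2 ^ j * ((j:ℝ) + 3) ^ D)) ^ β) := by gcongr
      _ = ((2:ℝ) ^ j) ^ (-r) * ((1 / 2) ^ (1 - 1 / θ.toReal) *
          ((5 * C) ^ β * (((2:ℝ) ^ j) ^ β * (((j:ℝ) + 3) ^ D) ^ β))) := by
        rw [one_mul, Real.mul_rpow (x := 5 * C) (by positivity) (by positivity),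
          Real.mul_rpow (x := 2 ^ j) (by positivity) (by positivity)]
      _ ≤ ((2:ℝ) ^ j) ^ (-r) * ((1 / 2) ^ (1 - 1 / θ.toReal) *
          ((5 * C) ^ β * (((2:ℝ) ^ j) ^ β * ((j:ℝ) + 3) ^ D))) := by
        gcongr
        exact Real.rpow_le_self_of_one_le hL hβ1
      _ = G j := by
        rw [hG]
        simp only
        rw [show -(r - β) = -r + β by ring, Real.rpow_add (by positivity)]
        ring
  have hpart : ∀ J, ∑ k ∈ F J, ‖fCoeff (D + 1) f k‖ ≤
      ∑ k ∈ F 0, ‖fCoeff (D + 1) f k‖ + ∑ j ∈ Finset.range J, G j := by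
    intro J
    induction J with
    | zero => simp
    | succ J ih =>
      rw [Finset.sum_range_succ, ← Finset.sum_sdiff (hypCross_two_pow_subset_succ _ zero_le_one J)]
      linarith [hblock J]
  refine summable_of_sum_le (fun k => norm_nonneg _)
    (c := ∑ k ∈ F 0, ‖fCoeff (D + 1) f k‖ + ∑' j, G j) fun u => ?_
  obtain ⟨J, hJ⟩ := exists_subset_hypCross_two_pow (D + 1) zero_lt_one u
  calc _ ≤ ∑ k ∈ F J, ‖fCoeff (D + 1) f k‖ :=
        Finset.sum_le_sum_of_subset_of_nonneg hJ fun k _ _ => norm_nonneg _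
    _ ≤ _ := (hpart J).trans (by gcongr; exact hsum.sum_le_tsum _ fun j _ => hG0 j)

/-- The upper bound in terms of a radius `R` whose hyperbolic cross has at most `m / 2` elements. -/
lemma exists_sigmaF_le (D : ℕ) {r : ℝ} {θ : ℝ≥0∞} (hθ : 0 < θ)
    (hr : max (1 - 1 / θ.toReal) 0 < r) {q : ℝ≥0∞}
    (hq : (2 ≤ q ∧ q ≠ ∞) ∨ (q = ∞ ∧ D + 1 = 1)) {C : ℝ} (hC1 : 1 ≤ C)
    (hC : ∀ ρ : ℝ, 1 ≤ ρ → ((hypCross (D + 1) ρ).card : ℝ) ≤ C * ρ * (1 + Real.log ρ) ^ D) :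
    ∃ A : ℝ, 0 < A ∧ ∀ (m : ℕ) (R : ℝ), 1 ≤ R → R ≤ m →
      C * R * (1 + Real.log R) ^ D ≤ m / 2 →
      ∀ f ∈ unitBall (D + 1) (wienerNorm (D + 1) r θ),
        sigmaF (D + 1) m (LqNorm (D + 1) q) f ≤
          ENNReal.ofReal (A * ((m:ℝ) ^ (1 / 2 - 1 / θ.toReal) * R ^ (-r))) := by
  classical
  set s := 1 / θ.toReal with hs
  set β := max (1 - s) 0 with hβ
  have hs0 : 0 ≤ s := by positivity
  have hβ0 : 0 ≤ β := le_max_right _ _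
  have hβ1 : β ≤ 1 := max_le (by linarith) zero_le_one
  have hr0 : 0 ≤ r := hβ0.trans hr.le
  have hg : 0 < r - β := sub_pos.2 hr
  set ε := min 1 ((r - β) / (4 * (s + 2))) with hε
  have hε0 : 0 < ε := by positivity
  have hε1 : ε ≤ 1 := min_le_left _ _
  have hεg : ε * (s + 2) ≤ (r - β) / 4 := by
    calc ε * (s + 2) ≤ (r - β) / (4 * (s + 2)) * (s + 2) := by
          gcongr
          exact min_le_right _ _
      _ = _ := by field_simp
  set δ := min ((r - β) / 8) (1 / 4) with hδ
  have hδ0 : 0 < δ := by positivity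
  have hδg : δ ≤ (r - β) / 8 := min_le_left _ _
  have hδ1 : δ < 1 / 2 := (min_le_right _ _).trans_lt (by norm_num)
  obtain ⟨K, hK1, hK⟩ := exists_sparse_trigSum hq hδ0 hδ1
  set x : ℝ := 2 ^ (-ε) with hx
  have hx0 : 0 < x := by positivity
  have hx1 : x < 1 := Real.rpow_lt_one_of_one_lt_of_neg one_lt_two (by linarith)
  set a := (1 - x) / 4 with ha
  have ha0 : 0 < a := by rw [ha]; linarith
  have ha1 : a ≤ 1 := by rw [ha]; linarith
  have hsum := summable_two_pow_rpow_neg_mul (half_pos hg) D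
  set G := fun j : ℕ => ((2:ℝ) ^ j) ^ (-((r - β) / 2)) * ((j:ℝ) + 3) ^ D with hG
  have hG0 : ∀ j, 0 < G j := fun j => by positivity
  have hGt : 0 < ∑' j, G j := hsum.tsum_pos (fun j => (hG0 j).le) 0 (hG0 0)
  set c := a ^ (1 / 2 - s) * (3 / a) ^ δ * (2 / a) ^ β with hc
  have hc0 : 0 < c := by positivity
  refine ⟨2 * (K * c * ∑' j, G j), by positivity, fun m R hR hRm hM f hf => ?_⟩
  have hm0 : (0:ℝ) < m := by linarith
  have hR0 : 0 < R := by linarith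
  set F := fun j : ℕ => hypCross (D + 1) (R * 2 ^ j) with hF
  set W := (m:ℝ) ^ (1 / 2 - s) * R ^ (-r) with hW
  have hW0 : 0 < W := by positivity
  have key := sigmaF_le_of_blocks (m := m) (q := q) (F := F)
    (T := fun j => 2 * (a * m * ((2:ℝ) ^ j) ^ (-ε))) (E := fun j => K * (c * W * G j))
    (S := K * c * (∑' j, G j) * W) ?_ hf.1
    (summable_norm_fCoeff hθ hr hf.2) (hypCross_two_pow_subset_succ _ hR0.le)
    (fun k => ?_) (fun j => by have := hG0 j; positivity) (fun j => ?_) (fun J => ?_) (by positivity)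
    (fun J => ?_)
  · refine key.trans_eq ?_
    congr 1
    ring
  · rcases hq with hq | hq
    · exact one_le_two.trans hq.1
    · rw [hq.1]
      exact le_top
  · obtain ⟨j, hj⟩ := exists_subset_hypCross_two_pow (D + 1) hR0 {k}
    exact ⟨j, hj (Finset.mem_singleton_self k)⟩
  · have hy : (1:ℝ) ≤ 2 ^ j := one_le_pow₀ one_le_two
    have hL : (1:ℝ) ≤ ((j:ℝ) + 3) ^ D := one_le_pow₀ (by linarith [j.cast_nonneg (α := ℝ)])
    have hN : ((F (j + 1) \ F j).card : ℝ) ≤ m * 2 ^ j * ((j:ℝ) + 3) ^ D :=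
      (Nat.cast_le.2 (Finset.card_le_card Finset.sdiff_subset)).trans
        ((card_hypCross_two_pow_le hC (by linarith) hR hM j).trans_eq (by ring))
    obtain ⟨n, u, hu, hn, hb⟩ := exists_sparse_block hθ hr0 (by linarith) hK hf.2
      (F := F (j + 1) \ F j) (one_le_mul_of_one_le_of_one_le hR hy)
      (fun k hk => (wt_of_mem_hypCross_sdiff hk).1) (fun k hk => (wt_of_mem_hypCross_sdiff hk).2)
      (t := a * m * ((2:ℝ) ^ j) ^ (-ε)) (by positivity)
    refine ⟨n, u, hu, hn, hb.trans (ENNReal.ofReal_le_ofReal ?_)⟩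
    have := block_error_le hm0 hR0 hRm hy hL ha0 ha1 rfl (Nat.cast_nonneg _) hN hβ0 hβ1
      hδ0.le hε0.le hε1 hεg hδg
    calc _ = K * _ := by rw [mul_assoc, mul_assoc, ← mul_assoc (_ ^ (-(1 / 2) : ℝ))]
      _ ≤ _ := by
        gcongr
  · have h0 : ((F 0).card : ℝ) ≤ m / 2 := by
      simp only [hF, pow_zero, mul_one]
      exact (hC R hR).trans hM
    have h1 : ∑ j ∈ Finset.range J, 2 * (a * m * ((2:ℝ) ^ j) ^ (-ε)) ≤ m / 2 := by
      simp_rw [two_pow_rpow_eq, ← hx, ← Finset.mul_sum]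
      have := (summable_geometric_of_lt_one hx0.le hx1).sum_le_tsum (Finset.range J)
        fun j _ => by positivity
      rw [tsum_geometric_of_lt_one hx0.le hx1] at this
      calc _ ≤ 2 * (a * m * (1 - x)⁻¹) := by gcongr
        _ = m / 2 := by
          have : 1 - x ≠ 0 := by linarith
          rw [ha]
          field_simp
          ring
    linarith
  · rw [← Finset.mul_sum, ← Finset.mul_sum]
    calc _ ≤ K * (c * W * ∑' j, G j) := by
          gcongr
          exact hsum.sum_le_tsum _ fun j _ => (hG0 j).le
      _ = _ := by ring

/-! ### Lower bound -/

lemma ofReal_sqrt_sum_le_LqNorm {d : ℕ} {q : ℝ≥0∞} (hq : 2 ≤ q) (Λ : Finset (Fin d → ℤ))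
    (a : (Fin d → ℤ) → ℂ) :
    ENNReal.ofReal (√(∑ k ∈ Λ, ‖a k‖ ^ 2)) ≤
      LqNorm d q (fun x => ∑ k ∈ Λ, a k * expk d k x) := by
  calc ENNReal.ofReal (√(∑ k ∈ Λ, ‖a k‖ ^ 2))
      = eLpNorm (fun x => ∑ k ∈ Λ, a k * expk d k x) 2 (cubeMeasure d) := by
        rw [(memLp_trigSum d 2 Λ a).eLpNorm_eq_integral_rpow_norm two_ne_zero ENNReal.ofNat_ne_top,
          ← integral_normSq_trigSum d Λ a, Real.sqrt_eq_rpow]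
        simp
    _ ≤ _ := eLpNorm_le_eLpNorm_of_exponent_le hq
        (continuous_trigSum d Λ a).aestronglyMeasurable

lemma wienerNorm_const_trigSum_le_one {d : ℕ} {r : ℝ} (hr : 0 ≤ r) {θ : ℝ≥0∞} (hθ : 0 < θ)
    {R : ℝ} (hR : 0 < R) {Γ : Finset (Fin d → ℤ)} (hΓ : Γ ⊆ hypCross d R) (hΓ0 : 0 < Γ.card) :
    wienerNorm d r θ (fun x => ∑ k ∈ Γ,
      ((R ^ (-r) * (Γ.card : ℝ) ^ (-(1 / θ.toReal)) : ℝ) : ℂ) * expk d k x) ≤ 1 := by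
  have hN : (0:ℝ) < Γ.card := by exact_mod_cast hΓ0
  set u := (Γ.card : ℝ) ^ (-(1 / θ.toReal)) with hu
  have hu0 : 0 < u := by positivity
  set f := fun x => ∑ k ∈ Γ, ((R ^ (-r) * u : ℝ) : ℂ) * expk d k x with hf
  have hin : ∀ k ∈ Γ, ENNReal.ofReal (wt d k ^ r) * (‖fCoeff d f k‖₊ : ℝ≥0∞) ≤
      ENNReal.ofReal u := by
    intro k hk
    have hk' := mem_hypCross.1 (hΓ hk)
    have hw := wt_pos d k
    have e : (‖fCoeff d f k‖₊ : ℝ≥0∞) = ENNReal.ofReal (R ^ (-r) * u) := by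
      rw [hf, fCoeff_trigSum d Γ (fun _ => ((R ^ (-r) * u : ℝ) : ℂ)), if_pos hk,
        ← enorm_eq_nnnorm, ← ofReal_norm, Complex.norm_real, Real.norm_of_nonneg (by positivity)]
    rw [e, ← ENNReal.ofReal_mul (by positivity)]
    refine ENNReal.ofReal_le_ofReal ?_
    rw [← mul_assoc, Real.rpow_neg hR.le, ← div_eq_mul_inv]
    refine mul_le_of_le_one_left hu0.le ((div_le_one (by positivity)).2 (by gcongr))
  have hout : ∀ k ∉ Γ, ENNReal.ofReal (wt d k ^ r) * (‖fCoeff d f k‖₊ : ℝ≥0∞) = 0 := by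
    intro k hk
    rw [hf, fCoeff_trigSum d Γ (fun _ => ((R ^ (-r) * u : ℝ) : ℂ)), if_neg hk]
    simp
  rw [wienerNorm]
  split_ifs with h
  · have hu1 : u = 1 := by simp [hu, h]
    refine iSup_le fun k => ?_
    by_cases hk : k ∈ Γ
    · simpa [hu1] using hin k hk
    · rw [hout k hk]
      exact zero_le_one
  · have hp : 0 < θ.toReal := ENNReal.toReal_pos hθ.ne' h
    rw [one_div, ENNReal.rpow_inv_le_iff hp, ENNReal.one_rpow,
      tsum_eq_sum (s := Γ) fun k hk => by rw [hout k hk, ENNReal.zero_rpow_of_pos hp]]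
    calc _ ≤ ∑ _k ∈ Γ, ENNReal.ofReal (Γ.card : ℝ)⁻¹ := by
          refine Finset.sum_le_sum fun k hk => ?_
          refine (ENNReal.rpow_le_rpow (hin k hk) hp.le).trans_eq ?_
          rw [ENNReal.ofReal_rpow_of_pos hu0, hu, ← Real.rpow_mul hN.le, ← Real.rpow_neg_one]
          congr 2
          field_simp
      _ = 1 := by
          rw [Finset.sum_const, ENNReal.ofReal_inv_of_pos hN, ENNReal.ofReal_natCast, nsmul_eq_mul]
          exact ENNReal.mul_inv_cancel (by exact_mod_cast hΓ0.ne') (ENNReal.natCast_ne_top _)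

lemma le_LqNorm_const_trigSum_sub {d m : ℕ} {q : ℝ≥0∞} (hq : 2 ≤ q) {Γ : Finset (Fin d → ℤ)}
    (hΓ : 2 * m ≤ Γ.card) {ν : ℝ} (hν : 0 ≤ ν) {s : (Fin d → ℝ) → ℂ} (hs : s ∈ trigPoly d m) :
    ENNReal.ofReal (ν * √m) ≤ LqNorm d q ((fun x => ∑ k ∈ Γ, (ν : ℂ) * expk d k x) - s) := by
  classical
  obtain ⟨Λ, a, hc, rfl⟩ := hs
  have e : (fun x => ∑ k ∈ Γ, (ν : ℂ) * expk d k x) - (fun x => ∑ k ∈ Λ, a k * expk d k x) =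
      fun x => ∑ k ∈ Γ ∪ Λ, ((if k ∈ Γ then (ν : ℂ) else 0) + if k ∈ Λ then -a k else 0) *
        expk d k x := by
    rw [← trigSum_add_trigSum Γ Λ (fun _ => (ν : ℂ)) (fun k => -a k)]
    funext x
    simp [sub_eq_add_neg]
  rw [e]
  refine le_trans (ENNReal.ofReal_le_ofReal ?_) (ofReal_sqrt_sum_le_LqNorm hq _ _)
  have hcard : (m : ℝ) ≤ (Γ \ Λ).card := by
    have := Finset.le_card_sdiff Λ Γ
    exact_mod_cast (by omega : m ≤ (Γ \ Λ).card)
  calc ν * √m = √(ν ^ 2 * m) := by rw [Real.sqrt_mul (sq_nonneg ν), Real.sqrt_sq hν]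
    _ ≤ _ := by
      refine Real.sqrt_le_sqrt ?_
      calc ν ^ 2 * m ≤ ν ^ 2 * (Γ \ Λ).card := by gcongr
        _ = ∑ k ∈ Γ \ Λ,
            ‖(if k ∈ Γ then (ν : ℂ) else 0) + if k ∈ Λ then -a k else 0‖ ^ 2 := by
          rw [mul_comm, ← nsmul_eq_mul, ← Finset.sum_const]
          refine Finset.sum_congr rfl fun k hk => ?_
          obtain ⟨h1, h2⟩ := Finset.mem_sdiff.1 hk
          simp [h1, h2]
        _ ≤ _ := Finset.sum_le_sum_of_subset_of_nonneg
          (Finset.sdiff_subset.trans Finset.subset_union_left) fun _ _ _ => sq_nonneg _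

lemma le_sigmaClass {d m : ℕ} (hm : 0 < m) {r : ℝ} (hr : 0 ≤ r) {θ : ℝ≥0∞} (hθ : 0 < θ)
    {q : ℝ≥0∞} (hq : 2 ≤ q) {R : ℝ} (hR : 0 < R) (hRm : 2 * m ≤ (hypCross d R).card) :
    ENNReal.ofReal (2 ^ (-(1 / θ.toReal)) * ((m:ℝ) ^ (1 / 2 - 1 / θ.toReal) * R ^ (-r))) ≤
      sigmaClass d m (wienerNorm d r θ) (LqNorm d q) := by
  obtain ⟨Γ, hΓ, hc⟩ := Finset.exists_subset_card_eq hRm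
  have hN := wienerNorm_const_trigSum_le_one hr hθ hR hΓ (by omega)
  have hm0 : (0:ℝ) < m := by exact_mod_cast hm
  refine le_trans ?_ (le_iSup₂ (f := fun f (_ : f ∈ unitBall d (wienerNorm d r θ)) =>
    sigmaF d m (LqNorm d q) f) _ ⟨?_, hN⟩)
  · refine le_iInf₂ fun s hs => le_trans (le_of_eq ?_)
      (le_LqNorm_const_trigSum_sub hq hc.ge (by positivity) hs)
    congr 1
    rw [hc, sub_eq_add_neg, Real.rpow_add hm0, Real.sqrt_eq_rpow]
    push_cast
    rw [Real.mul_rpow zero_le_two hm0.le]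
    ring
  · exact memLp_one_iff_integrable.1 (memLp_trigSum d 1 Γ fun _ => _)

/-! ### The asymptotics -/

lemma one_le_logStar (m : ℕ) : 1 ≤ logStar m := le_max_right _ _

lemma logStar_eq {m : ℕ} (hm : 2 ≤ m) : logStar m = Real.log m / Real.log 2 := by
  refine max_eq_left ?_
  rw [Real.le_logb_iff_rpow_le one_lt_two (by positivity), Real.rpow_one]
  exact_mod_cast hm

lemma log_le_logStar {m : ℕ} (hm : 2 ≤ m) : Real.log m ≤ logStar m := by
  rw [logStar_eq hm]
  exact le_div_self (Real.log_natCast_nonneg m) (Real.log_pos one_lt_two)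
    (Real.log_two_lt_d9.le.trans (by norm_num))

lemma logStar_le_two_mul_log {m : ℕ} (hm : 2 ≤ m) : logStar m ≤ 2 * Real.log m := by
  rw [logStar_eq hm, div_le_iff₀ (Real.log_pos one_lt_two)]
  nlinarith [Real.log_natCast_nonneg m, Real.log_two_gt_d9]

lemma eventually_mul_logStar_pow_le_sqrt (D : ℕ) {M : ℝ} (hM : 0 < M) :
    ∀ᶠ m : ℕ in Filter.atTop, M * logStar m ^ D ≤ √m := by
  have h := ((isLittleO_log_rpow_rpow_atTop (D : ℝ) one_half_pos).comp_tendsto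
    tendsto_natCast_atTop_atTop).bound (c := (M * 2 ^ D)⁻¹) (by positivity)
  filter_upwards [h, Filter.eventually_ge_atTop 2] with m hm hm2
  have hl := Real.log_natCast_nonneg m
  simp only [Function.comp_apply, Real.rpow_natCast] at hm
  rw [← Real.sqrt_eq_rpow, Real.norm_of_nonneg (by positivity),
    Real.norm_of_nonneg (by positivity), ← div_eq_inv_mul, le_div_iff₀ (by positivity)] at hm
  have := zero_le_one.trans (one_le_logStar m)
  calc M * logStar m ^ D ≤ M * (2 * Real.log m) ^ D := by
        gcongr
        exact logStar_le_two_mul_log hm2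
    _ = Real.log m ^ D * (M * 2 ^ D) := by
        rw [mul_pow]
        ring
    _ ≤ √m := hm

lemma rpow_mul_div_rpow_neg {m l c r s : ℝ} (hm : 0 < m) (hl : 0 < l) (hc : 0 < c) (D : ℕ) :
    m ^ (1 / 2 - s) * (c * m / l ^ D) ^ (-r) =
      c ^ (-r) * (m ^ (-(r + s - 1 / 2)) * l ^ ((((D + 1 : ℕ) : ℝ) - 1) * r)) := by
  rw [Real.div_rpow (by positivity) (by positivity), Real.mul_rpow hc.le hm.le,
    Real.rpow_neg (by positivity : 0 ≤ l ^ D), div_inv_eq_mul, ← Real.rpow_natCast,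
    ← Real.rpow_mul hl.le, show -(r + s - 1 / 2) = (1 / 2 - s) + -r by ring, Real.rpow_add hm]
  push_cast
  rw [add_sub_cancel_right]
  ring

lemma exists_sigmaClass_le (D : ℕ) {θ : ℝ≥0∞} (hθ : 0 < θ) {r : ℝ}
    (hr : max (1 - 1 / θ.toReal) 0 < r) {q : ℝ≥0∞}
    (hq : (2 ≤ q ∧ q ≠ ∞) ∨ (q = ∞ ∧ D + 1 = 1)) :
    ∃ A : ℝ, 0 < A ∧ ∀ᶠ m : ℕ in Filter.atTop,
      sigmaClass (D + 1) m (wienerNorm (D + 1) r θ) (LqNorm (D + 1) q) ≤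
        ENNReal.ofReal (A * ((m:ℝ) ^ (-(r + 1 / θ.toReal - 1 / 2)) *
          logStar m ^ ((((D + 1 : ℕ) : ℝ) - 1) * r))) := by
  obtain ⟨C, hC1, hC⟩ := exists_card_hypCross_le D
  obtain ⟨A, hA0, hA⟩ := exists_sigmaF_le D hθ hr hq hC1 hC
  have hc1 : 1 ≤ 2 * C * 2 ^ D := by
    have : (1:ℝ) ≤ 2 ^ D := one_le_pow₀ one_le_two
    nlinarith
  set M := 2 * C * 2 ^ D with hM
  have hM0 : 0 < M := by linarith
  refine ⟨A * M⁻¹ ^ (-r), by positivity, ?_⟩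
  filter_upwards [eventually_mul_logStar_pow_le_sqrt D hM0, Filter.eventually_ge_atTop 2]
    with m hm hm2
  have hm2' : (2:ℝ) ≤ m := by exact_mod_cast hm2
  have hm0 : (0:ℝ) < m := by linarith
  have hl := one_le_logStar m
  have hl0 : 0 < logStar m := by linarith
  have hden : M * logStar m ^ D ≤ m :=
    hm.trans ((Real.sqrt_le_left hm0.le).2 (le_self_pow₀ (by linarith) two_ne_zero))
  have hlD : 1 ≤ logStar m ^ D := one_le_pow₀ hl
  have hReq : M⁻¹ * m / logStar m ^ D = m / (M * logStar m ^ D) := by field_simp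
  have hR1 : 1 ≤ M⁻¹ * m / logStar m ^ D := by
    rw [hReq]
    exact (one_le_div (by positivity)).2 hden
  have hRm : M⁻¹ * m / logStar m ^ D ≤ m := by
    rw [hReq]
    exact div_le_self hm0.le (one_le_mul_of_one_le_of_one_le hc1 hlD)
  have hlog : 1 + Real.log (M⁻¹ * m / logStar m ^ D) ≤ 2 * logStar m := by
    have := (Real.log_le_log (by linarith) hRm).trans (log_le_logStar hm2)
    linarith
  refine iSup₂_le fun f hf => (hA m _ hR1 hRm ?_ f hf).trans_eq ?_
  · have := Real.log_nonneg hR1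
    calc _ ≤ C * (M⁻¹ * m / logStar m ^ D) * (2 * logStar m) ^ D := by gcongr
      _ = m / 2 := by
        rw [hM, mul_pow]
        field_simp
  · rw [rpow_mul_div_rpow_neg hm0 hl0 (by positivity), mul_assoc]

lemma exists_le_sigmaClass (D : ℕ) {θ : ℝ≥0∞} (hθ : 0 < θ) {r : ℝ} (hr : 0 ≤ r) {q : ℝ≥0∞}
    (hq : 2 ≤ q) :
    ∃ A : ℝ, 0 < A ∧ ∀ᶠ m : ℕ in Filter.atTop,
      ENNReal.ofReal (A * ((m:ℝ) ^ (-(r + 1 / θ.toReal - 1 / 2)) *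
          logStar m ^ ((((D + 1 : ℕ) : ℝ) - 1) * r))) ≤
        sigmaClass (D + 1) m (wienerNorm (D + 1) r θ) (LqNorm (D + 1) q) := by
  obtain ⟨c, hc0, hc⟩ := exists_le_card_hypCross D
  set M := max 1 (2 * 4 ^ D / c) with hM
  have hM1 : 1 ≤ M := le_max_left _ _
  refine ⟨2 ^ (-(1 / θ.toReal)) * M ^ (-r), by positivity, ?_⟩
  filter_upwards [eventually_mul_logStar_pow_le_sqrt D one_pos, Filter.eventually_ge_atTop 2]
    with m hm hm2
  have hm2' : (2:ℝ) ≤ m := by exact_mod_cast hm2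
  have hm0 : (0:ℝ) < m := by linarith
  have hl0 : 0 < logStar m := zero_lt_one.trans_le (one_le_logStar m)
  have hsqrt : √m ≤ M * m / logStar m ^ D := by
    rw [le_div_iff₀ (by positivity)]
    rw [one_mul] at hm
    calc √m * logStar m ^ D ≤ √m * √m := by gcongr
      _ = 1 * m := by rw [Real.mul_self_sqrt hm0.le, one_mul]
      _ ≤ M * m := by gcongr
  have hR1 : 1 ≤ M * m / logStar m ^ D :=
    (Real.one_le_sqrt.2 (by linarith)).trans hsqrt
  have hlog : logStar m / 4 ≤ Real.log (M * m / logStar m ^ D) := by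
    have h1 := Real.log_le_log (by positivity) hsqrt
    rw [Real.log_sqrt hm0.le] at h1
    linarith [logStar_le_two_mul_log hm2]
  have hcard : 2 * m ≤ (hypCross (D + 1) (M * m / logStar m ^ D)).card := by
    have : (2:ℝ) * m ≤ (hypCross (D + 1) (M * m / logStar m ^ D)).card := by
      refine le_trans ?_ (hc _ hR1)
      calc 2 * (m:ℝ) = c * (2 * 4 ^ D / c * m / logStar m ^ D) * (logStar m / 4) ^ D := by
            rw [div_pow]
            field_simp
        _ ≤ c * (M * m / logStar m ^ D) * (logStar m / 4) ^ D := by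
            gcongr
            exact le_max_right _ _
        _ ≤ _ := by gcongr
    exact_mod_cast this
  refine le_trans (le_of_eq ?_) (le_sigmaClass (by omega) hr hθ hq (by positivity) hcard)
  rw [rpow_mul_div_rpow_neg hm0 hl0 (by positivity), mul_assoc]

/-- `σ_m(S^r_θ A)_{L_q} ≍ m^{-(r+1/θ-1/2)} (log* m)^{(d-1)r}`
for `0 < θ ≤ ∞`, `r > (1-1/θ)₊`, and `2 ≤ q < ∞` (or `q = ∞` if `d = 1`). -/
theorem statement3 (d : ℕ) (hd : 1 ≤ d) (θ : ℝ≥0∞) (hθ : 0 < θ) (r : ℝ)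
    (hr : max (1 - 1/θ.toReal) 0 < r) (q : ℝ≥0∞)
    (hq : (2 ≤ q ∧ q ≠ ∞) ∨ (q = ∞ ∧ d = 1)) :
    IsAsympEquiv (fun m => sigmaClass d m (wienerNorm d r θ) (LqNorm d q))
      (fun m => (m : ℝ) ^ (-(r + 1/θ.toReal - 1/2)) *
        logStar m ^ (((d : ℝ) - 1) * r)) := by
  obtain ⟨D, rfl⟩ := Nat.exists_eq_add_of_le' hd
  have hq2 : 2 ≤ q := by
    rcases hq with hq | hq
    · exact hq.1
    · rw [hq.1]
      exact le_top
  obtain ⟨c, hc0, hc⟩ := exists_le_sigmaClass D hθ ((le_max_right _ _).trans hr.le) hq2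
  obtain ⟨C, hC0, hC⟩ := exists_sigmaClass_le D hθ hr hq
  obtain ⟨m₀, h⟩ := Filter.eventually_atTop.1 (hc.and hC)
  exact ⟨c, C, hc0, hC0, m₀, h⟩

end Paper
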